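/- arXiv:1908.00607 — 2 statements merged into one kernel-verified Lean document; each statement's English description precedes it below -/
import Mathlib

section
/- Let 2 < p < 5 and 1 < γ₀ < min{2, p−1}. There exists a constant C > 0, depending only on p and γ₀, such that every smooth solution φ of the defocusing semilinear wave equation with E_{0,γ₀}[φ] < ∞ satisfies the weighted energy flux bound through the future hyperboloid: ∫₀^∞ ∫_{S²} [ ρ(t)^{γ₀} |L(rφ)|² + |L̄φ|² + ρ(t)² |Lφ|² + |∇̄(rφ)|² + (2ρ(t)²/(p+1)) |φ|^{p+1} ](t, ρ(t)ω) dσ(ω) dt ≤ C · E_{0,γ₀}[φ], where rφ denotes the function (t,x) ↦ |x| φ(t,x). -/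
open MeasureTheory Real
open scoped ENNReal InnerProductSpace

noncomputable section

/-- Three-dimensional Euclidean space. -/
abbrev E3 : Type := EuclideanSpace ℝ (Fin 3)

/-- Second derivative of `f` at `x` in the direction `v`. -/
def der2 (f : E3 → ℝ) (x v : E3) : ℝ := fderiv ℝ (fun y => fderiv ℝ f y v) x v

/-- The (spatial) Laplacian on `ℝ³`. -/
def lap3 (f : E3 → ℝ) (x : E3) : ℝ :=
  ∑ i : Fin 3, der2 f x (EuclideanSpace.single i 1)

/-- First time derivative `∂_t φ`. -/
def dt1 (φ : ℝ → E3 → ℝ) (t : ℝ) (x : E3) : ℝ := deriv (fun s => φ s x) t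

/-- Second time derivative `∂_t² φ`. -/
def dtt (φ : ℝ → E3 → ℝ) (t : ℝ) (x : E3) : ℝ := deriv (fun s => dt1 φ s x) t

/-- `φ` is a smooth solution of the defocusing semilinear wave equation
`∂_t²φ − Δφ + |φ|^{p−1}φ = 0` on `[0,∞) × ℝ³`. -/
def IsNLWSolution (p : ℝ) (φ : ℝ → E3 → ℝ) : Prop :=
  ContDiff ℝ (⊤ : ℕ∞) (fun q : ℝ × E3 => φ q.1 q.2) ∧
    ∀ t : ℝ, 0 ≤ t → ∀ x : E3,
      dtt φ t x - lap3 (φ t) x + |φ t x| ^ (p - 1) * φ t x = 0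

/-- The weighted initial energy `E_{k,γ₀}[φ]`. -/
def wEnergy (p : ℝ) (k : ℕ) (γ₀ : ℝ) (φ : ℝ → E3 → ℝ) : ℝ≥0∞ :=
  (∑ l ∈ Finset.range (k + 1),
    ∫⁻ x : E3, ENNReal.ofReal ((1 + ‖x‖) ^ (γ₀ + 2 * (l : ℝ)) *
      (‖iteratedFDeriv ℝ (l + 1) (φ 0) x‖ ^ 2 + ‖iteratedFDeriv ℝ l (dt1 φ 0) x‖ ^ 2))) +
  ∫⁻ x : E3, ENNReal.ofReal ((1 + ‖x‖) ^ γ₀ * |φ 0 x| ^ (p + 1))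

/-- `u₊ = √(1+((t−r)/2)²)`. -/
def uplus (t r : ℝ) : ℝ := Real.sqrt (1 + ((t - r) / 2) ^ 2)

/-- `v₊ = √(1+((t+r)/2)²)`. -/
def vplus (t r : ℝ) : ℝ := Real.sqrt (1 + ((t + r) / 2) ^ 2)

/-- Surface measure on the unit sphere `S² ⊂ ℝ³` (total mass `4π`). -/
def sphereMeasure : Measure (Metric.sphere (0 : E3) 1) := (volume : Measure E3).toSphere

/-- Radial derivative `∂_r ψ = (x/|x|)·∇ψ`. -/
def drad (φ : ℝ → E3 → ℝ) (t : ℝ) (x : E3) : ℝ := ⟪‖x‖⁻¹ • x, gradient (φ t) x⟫_ℝ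

/-- `Lψ = ∂_tψ + ∂_rψ`. -/
def Lop (φ : ℝ → E3 → ℝ) (t : ℝ) (x : E3) : ℝ := dt1 φ t x + drad φ t x

/-- `L̄ψ = ∂_tψ − ∂_rψ`. -/
def Lbop (φ : ℝ → E3 → ℝ) (t : ℝ) (x : E3) : ℝ := dt1 φ t x - drad φ t x

/-- Angular gradient `∇̄ψ = ∇ψ − (x/|x|)∂_rψ`. -/
def angGrad (φ : ℝ → E3 → ℝ) (t : ℝ) (x : E3) : E3 :=
  gradient (φ t) x - drad φ t x • (‖x‖⁻¹ • x)

/-- The function `(t,x) ↦ |x| φ(t,x)`. -/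
def rmul (φ : ℝ → E3 → ℝ) : ℝ → E3 → ℝ := fun t x => ‖x‖ * φ t x

/-- Radius `ρ(t) = √((t+3)² − (6/5)(t+3))` of the hyperboloid `ℍ⁺` at time `t`. -/
def hypRho (t : ℝ) : ℝ := Real.sqrt ((t + 3) ^ 2 - (6 / 5) * (t + 3))

open scoped Pointwise in
lemma measurePreserving_sphere_isometry (R : E3 ≃ₗᵢ[ℝ] E3)
    (g : Metric.sphere (0 : E3) 1 → Metric.sphere (0 : E3) 1)
    (hg : ∀ ω, (g ω : E3) = R ω) :
    MeasurePreserving g sphereMeasure sphereMeasure := by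
  have hgm : Measurable g :=
    (Continuous.subtype_mk (R.continuous.comp continuous_subtype_val)
      (fun ω => by rw [Function.comp, ← hg]; exact (g ω).2) |>.congr
      (fun ω => Subtype.ext (hg ω).symm)).measurable
  refine ⟨hgm, Measure.ext fun s hs => ?_⟩
  rw [Measure.map_apply hgm hs, sphereMeasure, Measure.toSphere_apply' _ (hgm hs),
    Measure.toSphere_apply' _ hs]
  congr 1
  have key : (Set.Ioo (0 : ℝ) 1 • ((fun ω : Metric.sphere (0 : E3) 1 => (ω : E3)) '' (g ⁻¹' s)))
      = R ⁻¹' (Set.Ioo (0 : ℝ) 1 • ((fun ω : Metric.sphere (0 : E3) 1 => (ω : E3)) '' s)) := by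
    ext x
    simp only [Set.mem_smul, Set.mem_image, Set.mem_preimage]
    constructor
    · rintro ⟨a, ha, _, ⟨ω, hω, rfl⟩, rfl⟩
      exact ⟨a, ha, _, ⟨g ω, hω, rfl⟩, by rw [hg, map_smul]⟩
    · rintro ⟨a, ha, _, ⟨ω, hω, rfl⟩, hx⟩
      have hmem : R.symm (ω : E3) ∈ Metric.sphere (0 : E3) 1 := by
        have := ω.2
        simp only [mem_sphere_zero_iff_norm] at this ⊢
        rw [R.symm.norm_map, this]
      refine ⟨a, ha, _, ⟨⟨R.symm ω, hmem⟩, ?_, rfl⟩, ?_⟩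
      · have : g ⟨R.symm ω, hmem⟩ = ω := Subtype.ext (by rw [hg]; simp)
        rw [this]; exact hω
      · apply R.injective
        rw [map_smul, ← hx]; simp
  rw [key]
  exact (R.measurePreserving).measure_preimage_equiv (f := R.toHomeomorph.toMeasurableEquiv) _

instance : IsFiniteMeasure sphereMeasure := by unfold sphereMeasure; infer_instance

lemma lintegral_polar_E3 {w : E3 → ℝ≥0∞} (hw : Measurable w) :
    ∫⁻ x, w x = ∫⁻ ω : Metric.sphere (0 : E3) 1, (∫⁻ r in Set.Ioi (0 : ℝ),
      ENNReal.ofReal (r ^ 2) * w (r • (ω : E3))) ∂sphereMeasure := by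
  have hdim : Module.finrank ℝ E3 - 1 = 2 := by simp [E3]
  have hmp := (volume : Measure E3).measurePreserving_homeomorphUnitSphereProd
  have hsymm : ∀ x : ({(0 : E3)}ᶜ : Set E3), w x
      = (fun q : Metric.sphere (0 : E3) 1 × Set.Ioi (0 : ℝ) => w ((q.2 : ℝ) • (q.1 : E3)))
        (homeomorphUnitSphereProd E3 x) := by
    intro x
    have h0 : ‖(x : E3)‖ ≠ 0 := norm_ne_zero_iff.2 x.2
    simp [smul_smul, mul_inv_cancel₀ h0]
  have hwm : Measurable (fun q : Metric.sphere (0 : E3) 1 × Set.Ioi (0 : ℝ) =>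
      w ((q.2 : ℝ) • (q.1 : E3))) := hw.comp (by fun_prop)
  calc ∫⁻ x, w x = ∫⁻ x : ({(0 : E3)}ᶜ : Set E3), w x ∂((volume : Measure E3).comap (↑)) := by
        rw [lintegral_subtype_comap (measurableSet_singleton _).compl, restrict_compl_singleton]
    _ = ∫⁻ q : Metric.sphere (0 : E3) 1 × Set.Ioi (0 : ℝ), w ((q.2 : ℝ) • (q.1 : E3))
          ∂(sphereMeasure.prod (Measure.volumeIoiPow 2)) := by
        rw [lintegral_congr hsymm, hmp.lintegral_comp hwm, hdim, sphereMeasure]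
    _ = _ := by
        rw [lintegral_prod _ hwm.aemeasurable]
        refine lintegral_congr fun ω => ?_
        rw [Measure.volumeIoiPow]
        refine (lintegral_withDensity_eq_lintegral_mul _ (by fun_prop)
          (hwm.comp measurable_prodMk_left)).trans ?_
        exact lintegral_subtype_comap measurableSet_Ioi
          (fun r : ℝ => ENNReal.ofReal (r ^ 2) * w (r • (ω : E3)))

/-- The standard basis vectors of `ℝ³`. -/
def bvec (i : Fin 3) : E3 := EuclideanSpace.single i 1

/-- Infinitesimal rotation about the `k`-th coordinate axis. -/
def rotGen (k : Fin 3) (x : E3) : E3 := x (k + 1) • bvec (k + 2) - x (k + 2) • bvec (k + 1)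

/-- Rotation by the angle `θ` about the `k`-th coordinate axis. -/
def rotFun (k : Fin 3) (θ : ℝ) (x : E3) : E3 :=
  x k • bvec k + (cos θ * x (k + 1) - sin θ * x (k + 2)) • bvec (k + 1)
    + (sin θ * x (k + 1) + cos θ * x (k + 2)) • bvec (k + 2)

lemma norm_sq_E3 (x : E3) : ‖x‖ ^ 2 = x 0 ^ 2 + x 1 ^ 2 + x 2 ^ 2 := by
  rw [EuclideanSpace.norm_sq_eq, Fin.sum_univ_three]; simp

lemma continuous_rotGen (k : Fin 3) : Continuous (rotGen k) := by
  unfold rotGen; fun_prop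

lemma norm_rotFun (k : Fin 3) (θ : ℝ) (x : E3) : ‖rotFun k θ x‖ = ‖x‖ := by
  have h : ‖rotFun k θ x‖ ^ 2 = ‖x‖ ^ 2 := by
    rw [norm_sq_E3, norm_sq_E3]
    have hcs := sin_sq_add_cos_sq θ
    fin_cases k <;> simp [rotFun, bvec] <;>
      first
      | linear_combination (x 1 ^ 2 + x 2 ^ 2) * hcs
      | linear_combination (x 0 ^ 2 + x 2 ^ 2) * hcs
      | linear_combination (x 0 ^ 2 + x 1 ^ 2) * hcs
  exact (sq_eq_sq₀ (norm_nonneg _) (norm_nonneg _)).1 h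

/-- The rotation `rotFun k θ` as a linear isometric equivalence. -/
def rotIso (k : Fin 3) (θ : ℝ) : E3 ≃ₗᵢ[ℝ] E3 :=
  LinearIsometry.toLinearIsometryEquiv
    { toFun := rotFun k θ
      map_add' := fun x y => by simp only [rotFun, PiLp.add_apply]; module
      map_smul' := fun c x => by
        simp only [rotFun, PiLp.smul_apply, smul_eq_mul, RingHom.id_apply]; module
      norm_map' := norm_rotFun k θ } rfl

lemma hasDerivAt_rotFun (k : Fin 3) (θ : ℝ) (x : E3) :
    HasDerivAt (fun s => rotFun k s x) (rotGen k (rotFun k θ x)) θ := by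
  have h1 : HasDerivAt (fun s => rotFun k s x)
      ((0 : E3) + (-sin θ * x (k + 1) - cos θ * x (k + 2)) • bvec (k + 1)
        + (cos θ * x (k + 1) + -sin θ * x (k + 2)) • bvec (k + 2)) θ := by
    unfold rotFun
    exact ((hasDerivAt_const _ _).add ((((hasDerivAt_cos θ).mul_const _).sub
      ((hasDerivAt_sin θ).mul_const _)).smul_const _)).add
      ((((hasDerivAt_sin θ).mul_const _).add ((hasDerivAt_cos θ).mul_const _)).smul_const _)
  convert h1 using 1
  ext j
  fin_cases k <;> fin_cases j <;> simp [rotFun, rotGen, bvec] <;> ring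

/-- The integral over the sphere of an angular derivative vanishes. -/
lemma integral_sphere_rotGen (k : Fin 3) {h : E3 → ℝ} (hh : ContDiff ℝ 1 h) :
    ∫ ω : Metric.sphere (0 : E3) 1, fderiv ℝ h ω (rotGen k ω) ∂sphereMeasure = 0 := by
  have hF : Continuous (fun x : E3 => fderiv ℝ h x (rotGen k x)) :=
    (hh.continuous_fderiv (by norm_num)).clm_apply (continuous_rotGen k)
  have hrot : Continuous (fun q : ℝ × Metric.sphere (0 : E3) 1 => rotFun k q.1 q.2) := by
    unfold rotFun; fun_prop
  have hmem : ∀ θ (ω : Metric.sphere (0 : E3) 1), rotFun k θ ω ∈ Metric.sphere (0 : E3) 1 := by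
    intro θ ω
    have := ω.2
    simp only [mem_sphere_zero_iff_norm] at this ⊢
    rw [norm_rotFun, this]
  have inv : ∀ (θ : ℝ) (u : E3 → ℝ), Continuous u →
      ∫ ω : Metric.sphere (0 : E3) 1, u (rotFun k θ ω) ∂sphereMeasure
        = ∫ ω : Metric.sphere (0 : E3) 1, u ω ∂sphereMeasure := by
    intro θ u hu
    have hmp := measurePreserving_sphere_isometry (rotIso k θ)
      (fun ω => ⟨rotFun k θ ω, hmem θ ω⟩) (fun ω => rfl)
    have := integral_map (μ := sphereMeasure) hmp.measurable.aemeasurable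
      (f := fun ω : Metric.sphere (0 : E3) 1 => u ω)
      (hu.comp continuous_subtype_val).aestronglyMeasurable
    rw [hmp.map_eq] at this
    exact this.symm
  have hswap : ∫ θ in (0 : ℝ)..1, ∫ ω : Metric.sphere (0 : E3) 1,
        fderiv ℝ h (rotFun k θ ω) (rotGen k (rotFun k θ ω)) ∂sphereMeasure
      = ∫ ω : Metric.sphere (0 : E3) 1, (∫ θ in (0 : ℝ)..1,
        fderiv ℝ h (rotFun k θ ω) (rotGen k (rotFun k θ ω))) ∂sphereMeasure := by
    have hc : Continuous (Function.uncurry fun (θ : ℝ) (ω : Metric.sphere (0 : E3) 1) =>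
        fderiv ℝ h (rotFun k θ ω) (rotGen k (rotFun k θ ω))) := hF.comp hrot
    refine intervalIntegral_integral_swap ?_
    rw [← Measure.restrict_univ (μ := sphereMeasure), Measure.prod_restrict]
    exact (hc.continuousOn.integrableOn_compact
      (isCompact_uIcc.prod isCompact_univ)).mono_set
        (Set.prod_mono Set.uIoc_subset_uIcc le_rfl)
  have hL : ∀ θ : ℝ, ∫ ω : Metric.sphere (0 : E3) 1,
        fderiv ℝ h (rotFun k θ ω) (rotGen k (rotFun k θ ω)) ∂sphereMeasure
      = ∫ ω : Metric.sphere (0 : E3) 1, fderiv ℝ h ω (rotGen k ω) ∂sphereMeasure :=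
    fun θ => inv θ _ hF
  have hR : ∀ ω : Metric.sphere (0 : E3) 1, (∫ θ in (0 : ℝ)..1,
        fderiv ℝ h (rotFun k θ ω) (rotGen k (rotFun k θ ω)))
      = h (rotFun k 1 ω) - h (rotFun k 0 ω) := by
    intro ω
    refine intervalIntegral.integral_eq_sub_of_hasDerivAt (f := fun θ => h (rotFun k θ ω))
      (fun θ _ => ?_) ?_
    · exact ((hh.differentiable (by norm_num)) _).hasFDerivAt.comp_hasDerivAt θ
        (hasDerivAt_rotFun k θ ω)
    · exact (hF.comp (hrot.comp (by fun_prop : Continuous fun θ : ℝ => (θ, ω)))).intervalIntegrable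
        _ _
  simp only [hL, hR] at hswap
  have hint : ∀ θ, Integrable (fun ω : Metric.sphere (0 : E3) 1 => h (rotFun k θ ω))
      sphereMeasure := fun θ =>
    (hh.continuous.comp (hrot.comp (by fun_prop :
      Continuous fun ω : Metric.sphere (0 : E3) 1 => (θ, ω)))).integrable_of_hasCompactSupport
      (HasCompactSupport.of_compactSpace _)
  rw [integral_sub (hint 1) (hint 0), inv 1 h hh.continuous, inv 0 h hh.continuous, sub_self,
    intervalIntegral.integral_const] at hswap
  simpa using hswap

/-- Green's identity on the rectangle `[0,T] × [0,1]`. -/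
lemma rect_divergence {U V Ut Vs : ℝ → ℝ → ℝ} {T : ℝ} (hT : 0 ≤ T)
    (hUt : Continuous (Function.uncurry Ut)) (hVs : Continuous (Function.uncurry Vs))
    (hU : ∀ t ∈ Set.Icc 0 T, ∀ s ∈ Set.Icc (0 : ℝ) 1, HasDerivAt (fun τ => U τ s) (Ut t s) t)
    (hV : ∀ t ∈ Set.Icc 0 T, ∀ s ∈ Set.Icc (0 : ℝ) 1, HasDerivAt (fun σ => V t σ) (Vs t s) s) :
    ∫ t in (0 : ℝ)..T, ∫ s in (0 : ℝ)..1, (Ut t s + Vs t s)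
      = (∫ s in (0 : ℝ)..1, (U T s - U 0 s)) + ∫ t in (0 : ℝ)..T, (V t 1 - V t 0) := by
  have cU : ∀ t, Continuous (Ut t) := fun t => hUt.comp (by fun_prop : Continuous fun s => (t, s))
  have cV : ∀ t, Continuous (Vs t) := fun t => hVs.comp (by fun_prop : Continuous fun s => (t, s))
  have cU' : ∀ s, Continuous (fun t => Ut t s) := fun s =>
    hUt.comp (by fun_prop : Continuous fun t => (t, s))
  have h1 : ∫ t in (0 : ℝ)..T, ∫ s in (0 : ℝ)..1, (Ut t s + Vs t s)
      = (∫ t in (0 : ℝ)..T, ∫ s in (0 : ℝ)..1, Ut t s)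
        + ∫ t in (0 : ℝ)..T, ∫ s in (0 : ℝ)..1, Vs t s := by
    rw [← intervalIntegral.integral_add]
    · refine intervalIntegral.integral_congr fun t _ => ?_
      exact intervalIntegral.integral_add ((cU t).intervalIntegrable _ _)
        ((cV t).intervalIntegrable _ _)
    · exact (intervalIntegral.continuous_parametric_intervalIntegral_of_continuous' hUt
        0 1).intervalIntegrable _ _
    · exact (intervalIntegral.continuous_parametric_intervalIntegral_of_continuous' hVs
        0 1).intervalIntegrable _ _
  rw [h1]
  congr 1
  · rw [intervalIntegral_intervalIntegral_swap]
    · refine intervalIntegral.integral_congr fun s hs => ?_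
      rw [Set.uIcc_of_le zero_le_one] at hs
      refine intervalIntegral.integral_eq_sub_of_hasDerivAt (f := fun τ => U τ s) (fun t ht => ?_)
        ((cU' s).intervalIntegrable _ _)
      rw [Set.uIcc_of_le hT] at ht
      exact hU t ht s hs
    · exact (hUt.continuousOn.integrableOn_compact
        (isCompact_uIcc.prod isCompact_uIcc)).mono_set
          (Set.prod_mono Set.uIoc_subset_uIcc Set.uIoc_subset_uIcc)
  · refine intervalIntegral.integral_congr fun t ht => ?_
    rw [Set.uIcc_of_le hT] at ht
    refine intervalIntegral.integral_eq_sub_of_hasDerivAt (f := fun σ => V t σ) (fun s hs => ?_)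
      ((cV t).intervalIntegrable _ _)
    rw [Set.uIcc_of_le zero_le_one] at hs
    exact hV t ht s hs

/-- Density of the combined energy and `r^γ`-weighted energy current, in terms of the radius `r`,
the field `f`, its time and radial derivatives `a`, `b`, and the squared angular gradient `G`. -/
def curP (p γ r f a b G : ℝ) : ℝ :=
  r ^ 2 * (a ^ 2 / 2 + b ^ 2 / 2 + G / 2 + |f| ^ (p + 1) / (p + 1))
    + r ^ γ * (r * (a + b) + f) ^ 2 / 2 + r ^ γ * r ^ 2 * (G / 2 + |f| ^ (p + 1) / (p + 1))

/-- Radial flux of the combined energy and `r^γ`-weighted energy current. -/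
def curQ (p γ r f a b G : ℝ) : ℝ :=
  -r ^ 2 * a * b
    - r ^ γ * (r * (a + b) + f) ^ 2 / 2 + r ^ γ * r ^ 2 * (G / 2 + |f| ^ (p + 1) / (p + 1))

/-- Differential of `curP`. -/
def dcurP (p γ r f a b G r' f' a' b' G' : ℝ) : ℝ :=
  2 * r * r' * (a ^ 2 / 2 + b ^ 2 / 2 + G / 2 + |f| ^ (p + 1) / (p + 1))
    + r ^ 2 * (a * a' + b * b' + G' / 2 + |f| ^ (p - 1) * f * f')
    + γ * r ^ (γ - 1) * r' * (r * (a + b) + f) ^ 2 / 2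
    + r ^ γ * (r * (a + b) + f) * (r' * (a + b) + r * (a' + b') + f')
    + (γ * r ^ (γ - 1) * r' * r ^ 2 + r ^ γ * (2 * r * r')) * (G / 2 + |f| ^ (p + 1) / (p + 1))
    + r ^ γ * r ^ 2 * (G' / 2 + |f| ^ (p - 1) * f * f')

/-- Differential of `curQ`. -/
def dcurQ (p γ r f a b G r' f' a' b' G' : ℝ) : ℝ :=
  -(2 * r * r' * a * b) - r ^ 2 * (a' * b + a * b')
    - γ * r ^ (γ - 1) * r' * (r * (a + b) + f) ^ 2 / 2
    - r ^ γ * (r * (a + b) + f) * (r' * (a + b) + r * (a' + b') + f')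
    + (γ * r ^ (γ - 1) * r' * r ^ 2 + r ^ γ * (2 * r * r')) * (G / 2 + |f| ^ (p + 1) / (p + 1))
    + r ^ γ * r ^ 2 * (G' / 2 + |f| ^ (p - 1) * f * f')

section Derivatives

variable {p γ τ : ℝ} {r f a b G : ℝ → ℝ} {r' f' a' b' G' : ℝ}

lemma hasDerivAt_potential (hp : 0 < p) (hf : HasDerivAt f f' τ) :
    HasDerivAt (fun s => |f s| ^ (p + 1) / (p + 1)) (|f τ| ^ (p - 1) * f τ * f') τ := by
  have h := ((hasDerivAt_abs_rpow (f τ) (p := p + 1) (by linarith)).comp τ hf).div_const (p + 1)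
  refine h.congr_deriv ?_
  have : p + 1 - 2 = p - 1 := by ring
  rw [this]
  field_simp

lemma hasDerivAt_curP (hp : 0 < p) (hγ : 1 ≤ γ) (hr : HasDerivAt r r' τ)
    (hf : HasDerivAt f f' τ) (ha : HasDerivAt a a' τ) (hb : HasDerivAt b b' τ)
    (hG : HasDerivAt G G' τ) :
    HasDerivAt (fun s => curP p γ (r s) (f s) (a s) (b s) (G s))
      (dcurP p γ (r τ) (f τ) (a τ) (b τ) (G τ) r' f' a' b' G') τ := by
  have hV := hasDerivAt_potential hp hf
  have hW := (Real.hasDerivAt_rpow_const (x := r τ) (p := γ) (Or.inr hγ)).comp τ hr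
  have hL := (hr.mul (ha.add hb)).add hf
  have h := ((hr.pow 2).mul ((((ha.pow 2).div_const 2).add ((hb.pow 2).div_const 2)).add
    (hG.div_const 2) |>.add hV)).add ((hW.mul (hL.pow 2)).div_const 2) |>.add
    ((hW.mul (hr.pow 2)).mul ((hG.div_const 2).add hV))
  refine h.congr_deriv ?_
  simp only [dcurP, Function.comp_apply, Pi.add_apply, Pi.mul_apply, Pi.pow_apply]
  push_cast
  ring

lemma hasDerivAt_curQ (hp : 0 < p) (hγ : 1 ≤ γ) (hr : HasDerivAt r r' τ)
    (hf : HasDerivAt f f' τ) (ha : HasDerivAt a a' τ) (hb : HasDerivAt b b' τ)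
    (hG : HasDerivAt G G' τ) :
    HasDerivAt (fun s => curQ p γ (r s) (f s) (a s) (b s) (G s))
      (dcurQ p γ (r τ) (f τ) (a τ) (b τ) (G τ) r' f' a' b' G') τ := by
  have hV := hasDerivAt_potential hp hf
  have hW := (Real.hasDerivAt_rpow_const (x := r τ) (p := γ) (Or.inr hγ)).comp τ hr
  have hL := (hr.mul (ha.add hb)).add hf
  have h := ((((hr.pow 2).neg.mul ha).mul hb).sub ((hW.mul (hL.pow 2)).div_const 2)).add
    ((hW.mul (hr.pow 2)).mul ((hG.div_const 2).add hV))
  refine h.congr_deriv ?_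
  simp only [dcurQ, Function.comp_apply, Pi.add_apply, Pi.mul_apply, Pi.pow_apply, Pi.neg_apply]
  push_cast
  ring

end Derivatives

/-- The multiplier identity: for a field solving the wave equation (`heq`), the divergence of the
current is a total angular derivative minus nonnegative bulk terms. -/
lemma current_divergence_le {p γ r f a b G att atr brr Gt Gr S : ℝ} (hp : 0 < p) (hγ : 1 ≤ γ)
    (hγ2 : γ ≤ 2) (hγp : γ ≤ p - 1) (hr : 0 < r) (hG : 0 ≤ G)
    (heq : att - (brr + S) + |f| ^ (p - 1) * f = 0) :
    dcurP p γ r f a b G 0 a att atr Gt + dcurQ p γ r f a b G 1 b atr brr Gr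
      ≤ (a + r ^ (γ - 1) * (r * (a + b) + f)) * (r ^ 2 * S - 2 * r * b) + r ^ 2 * (Gt / 2)
        + r ^ (γ - 1) * (r ^ 3 * ((Gt + Gr) / 2) + 2 * r ^ 2 * G) := by
  have hW : r ^ γ = r * r ^ (γ - 1) := by
    rw [← rpow_one_add' hr.le (by linarith)]; congr 1; ring
  have hV : |f| ^ (p + 1) = |f| ^ (p - 1) * f * f := by
    have : p + 1 = (p - 1) + 2 := by ring
    rw [this, rpow_add_of_nonneg (abs_nonneg f) (by linarith) (by norm_num), rpow_two, sq_abs]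
    ring
  have hw : 0 ≤ r ^ (γ - 1) := rpow_nonneg hr.le _
  have hVn : 0 ≤ |f| ^ (p + 1) := rpow_nonneg (abs_nonneg f) _
  have h1 : 0 ≤ (2 - γ) / 2 * (r ^ (γ - 1) * r ^ 2 * G) :=
    mul_nonneg (by linarith) (by positivity)
  have h2 : 0 ≤ γ / 2 * (r ^ (γ - 1) * (r * (a + b) + f) ^ 2) :=
    mul_nonneg (by linarith) (by positivity)
  have h3 : 0 ≤ (p - 1 - γ) * (r ^ (γ - 1) * r ^ 2 * (|f| ^ (p + 1) / (p + 1))) :=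
    mul_nonneg (by linarith) (by positivity)
  have hq : |f| ^ (p + 1) / (p + 1) * (p + 1) = |f| ^ (p - 1) * f * f := by
    rw [← hV]; field_simp
  have hatt : att = brr + S - |f| ^ (p - 1) * f := by linarith
  have key : dcurP p γ r f a b G 0 a att atr Gt + dcurQ p γ r f a b G 1 b atr brr Gr
      = (a + r ^ (γ - 1) * (r * (a + b) + f)) * (r ^ 2 * S - 2 * r * b) + r ^ 2 * (Gt / 2)
        + r ^ (γ - 1) * (r ^ 3 * ((Gt + Gr) / 2) + 2 * r ^ 2 * G)
        - ((2 - γ) / 2 * (r ^ (γ - 1) * r ^ 2 * G)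
          + γ / 2 * (r ^ (γ - 1) * (r * (a + b) + f) ^ 2)
          + (p - 1 - γ) * (r ^ (γ - 1) * r ^ 2 * (|f| ^ (p + 1) / (p + 1)))) := by
    subst hatt
    simp only [dcurP, dcurQ, hW]
    generalize |f| ^ (p + 1) / (p + 1) = V at *
    generalize |f| ^ (p - 1) = N at *
    generalize r ^ (γ - 1) = w at *
    linear_combination (w * r ^ 2) * hq
  linarith [key]

lemma curP_nonneg {p γ r f a b G : ℝ} (hp : 0 < p) (hr : 0 ≤ r) (hG : 0 ≤ G) :
    0 ≤ curP p γ r f a b G := by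
  have := rpow_nonneg hr γ
  have := rpow_nonneg (abs_nonneg f) (p + 1)
  unfold curP
  positivity

lemma curP_add_curQ_nonneg {p γ r f a b G : ℝ} (hp : 0 < p) (hr : 0 ≤ r) (hG : 0 ≤ G) :
    0 ≤ curQ p γ r f a b G + curP p γ r f a b G := by
  have := rpow_nonneg hr γ
  have := rpow_nonneg (abs_nonneg f) (p + 1)
  have h : curQ p γ r f a b G + curP p γ r f a b G
      = r ^ 2 * ((a - b) ^ 2 / 2 + G / 2 + |f| ^ (p + 1) / (p + 1))
        + 2 * (r ^ γ * r ^ 2 * (G / 2 + |f| ^ (p + 1) / (p + 1))) := by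
    unfold curP curQ; ring
  rw [h]
  positivity

lemma sum_rotGen_clm_sq (ℓ : E3 →L[ℝ] ℝ) {ω : E3} (hω : ‖ω‖ = 1) :
    ℓ ω ^ 2 + ∑ k, ℓ (rotGen k ω) ^ 2 = ∑ i, ℓ (bvec i) ^ 2 := by
  have hn : ω 0 ^ 2 + ω 1 ^ 2 + ω 2 ^ 2 = 1 := by rw [← norm_sq_E3, hω]; norm_num
  have hx : ω = ω 0 • bvec 0 + ω 1 • bvec 1 + ω 2 • bvec 2 := by
    ext j; fin_cases j <;> simp [bvec]
  have e : ℓ ω = ω 0 * ℓ (bvec 0) + ω 1 * ℓ (bvec 1) + ω 2 * ℓ (bvec 2) := by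
    conv_lhs => rw [hx]
    simp
  rw [e]
  simp only [Fin.sum_univ_three, rotGen, map_sub, map_smul, smul_eq_mul]
  simp only [Fin.isValue, zero_add, Fin.reduceAdd]
  linear_combination (ℓ (bvec 0) ^ 2 + ℓ (bvec 1) ^ 2 + ℓ (bvec 2) ^ 2) * hn

lemma sum_rotGen_bilin (B : E3 →L[ℝ] E3 →L[ℝ] ℝ) {ω : E3} (hω : ‖ω‖ = 1) :
    B ω ω + ∑ k, B (rotGen k ω) (rotGen k ω) = ∑ i, B (bvec i) (bvec i) := by
  have hn : ω 0 ^ 2 + ω 1 ^ 2 + ω 2 ^ 2 = 1 := by rw [← norm_sq_E3, hω]; norm_num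
  have hx : ω = ω 0 • bvec 0 + ω 1 • bvec 1 + ω 2 • bvec 2 := by
    ext j; fin_cases j <;> simp [bvec]
  have e : B ω ω = B (ω 0 • bvec 0 + ω 1 • bvec 1 + ω 2 • bvec 2)
      (ω 0 • bvec 0 + ω 1 • bvec 1 + ω 2 • bvec 2) := by rw [← hx]
  rw [e]
  simp only [Fin.sum_univ_three, rotGen, map_sub, map_add, map_smul, smul_eq_mul,
    _root_.add_apply, _root_.sub_apply, _root_.smul_apply]
  simp only [Fin.isValue, zero_add, Fin.reduceAdd]
  linear_combination (B (bvec 0) (bvec 0) + B (bvec 1) (bvec 1) + B (bvec 2) (bvec 2)) * hn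

lemma sum_rotGen_rotGen (x : E3) : ∑ k, rotGen k (rotGen k x) = (-2 : ℝ) • x := by
  ext j
  simp only [Fin.sum_univ_three]
  fin_cases j <;> simp [rotGen, bvec] <;> ring

lemma norm_sq_clm_E3 (ℓ : E3 →L[ℝ] ℝ) : ‖ℓ‖ ^ 2 = ∑ i, ℓ (bvec i) ^ 2 := by
  have h1 : ‖(InnerProductSpace.toDual ℝ E3).symm ℓ‖ = ‖ℓ‖ := LinearIsometryEquiv.norm_map _ _
  have h2 : ∀ i, ℓ (bvec i) = ((InnerProductSpace.toDual ℝ E3).symm ℓ) i := by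
    intro i
    rw [← InnerProductSpace.toDual_symm_apply (𝕜 := ℝ) (x := bvec i) (y := ℓ), bvec,
      EuclideanSpace.inner_single_right]
    simp
  rw [← h1, norm_sq_E3]
  simp [Fin.sum_univ_three, h2]

section Jets

variable {Φ : ℝ × E3 → ℝ}

/-- Derivative of `Φ` at `(t, r ω)` in the direction `v`. -/
def jet1 (Φ : ℝ × E3 → ℝ) (t r : ℝ) (ω : E3) (v : ℝ × E3) : ℝ := fderiv ℝ Φ (t, r • ω) v

/-- Second derivative of `Φ` at `(t, r ω)` in the directions `v`, `w`. -/
def jet2 (Φ : ℝ × E3 → ℝ) (t r : ℝ) (ω : E3) (v w : ℝ × E3) : ℝ :=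
  fderiv ℝ (fderiv ℝ Φ) (t, r • ω) v w

lemma hasDerivAt_jet0 (hΦ : ContDiff ℝ 2 Φ) {t r : ℝ → ℝ} {t' r' τ : ℝ} (ω : E3)
    (ht : HasDerivAt t t' τ) (hr : HasDerivAt r r' τ) :
    HasDerivAt (fun s => Φ (t s, r s • ω))
      (t' * jet1 Φ (t τ) (r τ) ω (1, 0) + r' * jet1 Φ (t τ) (r τ) ω (0, ω)) τ := by
  have h := ((hΦ.differentiable (by norm_num)) (t τ, r τ • ω)).hasFDerivAt.comp_hasDerivAt τ
    (ht.prodMk (hr.smul_const ω))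
  refine h.congr_deriv ?_
  have : (t', r' • ω) = t' • ((1 : ℝ), (0 : E3)) + r' • ((0 : ℝ), ω) := by simp
  rw [this, map_add, map_smul, map_smul]; rfl

lemma hasDerivAt_jet1 (hΦ : ContDiff ℝ 2 Φ) {t r : ℝ → ℝ} {t' r' τ : ℝ} (ω : E3) (v : ℝ × E3)
    (ht : HasDerivAt t t' τ) (hr : HasDerivAt r r' τ) :
    HasDerivAt (fun s => jet1 Φ (t s) (r s) ω v)
      (t' * jet2 Φ (t τ) (r τ) ω (1, 0) v + r' * jet2 Φ (t τ) (r τ) ω (0, ω) v) τ := by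
  have hD : ContDiff ℝ 1 (fderiv ℝ Φ) := hΦ.fderiv_right (by norm_num)
  have h := ((hD.differentiable (by norm_num)) (t τ, r τ • ω)).hasFDerivAt.comp_hasDerivAt τ
    (ht.prodMk (hr.smul_const ω))
  have h' := h.clm_apply (hasDerivAt_const τ v)
  refine h'.congr_deriv ?_
  have : (t', r' • ω) = t' • ((1 : ℝ), (0 : E3)) + r' • ((0 : ℝ), ω) := by simp
  rw [this, map_add, map_smul, map_smul]
  simp [jet2]

lemma jet2_symm (hΦ : ContDiff ℝ 2 Φ) (t r : ℝ) (ω : E3) (v w : ℝ × E3) :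
    jet2 Φ t r ω v w = jet2 Φ t r ω w v :=
  (hΦ.contDiffAt.isSymmSndFDerivAt (by simp)) v w

section Continuity

variable {X : Type*} [TopologicalSpace X] {t r : X → ℝ} {ω : X → E3} {v w : X → ℝ × E3}

@[fun_prop]
lemma continuous_jet1 (hΦ : ContDiff ℝ 2 Φ) (ht : Continuous t) (hr : Continuous r)
    (hω : Continuous ω) (hv : Continuous v) :
    Continuous (fun x => jet1 Φ (t x) (r x) (ω x) (v x)) :=
  ((hΦ.continuous_fderiv (by norm_num)).comp (ht.prodMk (hr.smul hω))).clm_apply hv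

@[fun_prop]
lemma continuous_jet2 (hΦ : ContDiff ℝ 2 Φ) (ht : Continuous t) (hr : Continuous r)
    (hω : Continuous ω) (hv : Continuous v) (hw : Continuous w) :
    Continuous (fun x => jet2 Φ (t x) (r x) (ω x) (v x) (w x)) := by
  have hD : ContDiff ℝ 1 (fderiv ℝ Φ) := hΦ.fderiv_right (by norm_num)
  exact (((hD.continuous_fderiv (by norm_num)).comp (ht.prodMk (hr.smul hω))).clm_apply
    hv).clm_apply hw

end Continuity

/-- Squared angular gradient of `Φ` at `(t, r ω)`, for `|ω| = 1`. -/
def angSq (Φ : ℝ × E3 → ℝ) (t r : ℝ) (ω : E3) : ℝ := ∑ k, jet1 Φ t r ω (0, rotGen k ω) ^ 2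

/-- Derivative of `angSq` when the base point moves in the direction `v`. -/
def dangSq (Φ : ℝ × E3 → ℝ) (t r : ℝ) (ω : E3) (v : ℝ × E3) : ℝ :=
  ∑ k, 2 * jet1 Φ t r ω (0, rotGen k ω) * jet2 Φ t r ω v (0, rotGen k ω)

/-- Trace of the Hessian of `Φ` over the rotation directions. -/
def angTrace (Φ : ℝ × E3 → ℝ) (t r : ℝ) (ω : E3) : ℝ :=
  ∑ k, jet2 Φ t r ω (0, rotGen k ω) (0, rotGen k ω)

lemma angSq_nonneg (t r : ℝ) (ω : E3) : 0 ≤ angSq Φ t r ω :=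
  Finset.sum_nonneg fun _ _ => sq_nonneg _

lemma hasDerivAt_angSq (hΦ : ContDiff ℝ 2 Φ) {t r : ℝ → ℝ} {t' r' τ : ℝ} (ω : E3)
    (ht : HasDerivAt t t' τ) (hr : HasDerivAt r r' τ) :
    HasDerivAt (fun s => angSq Φ (t s) (r s) ω)
      (t' * dangSq Φ (t τ) (r τ) ω (1, 0) + r' * dangSq Φ (t τ) (r τ) ω (0, ω)) τ := by
  have h := HasDerivAt.fun_sum (u := Finset.univ) fun (k : Fin 3) _ =>
    (hasDerivAt_jet1 hΦ ω (0, rotGen k ω) ht hr).pow 2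
  refine h.congr_deriv ?_
  simp only [dangSq, Fin.sum_univ_three]
  push_cast
  ring

/-- Angular divergence produced by the multiplier `φ_t + r^(γ-1) L(rφ)`. -/
def angFlux (Φ : ℝ × E3 → ℝ) (γ t r : ℝ) (ω : E3) : ℝ :=
  (jet1 Φ t r ω (1, 0) + r ^ (γ - 1) *
      (r * (jet1 Φ t r ω (1, 0) + jet1 Φ t r ω (0, ω)) + Φ (t, r • ω)))
      * (r ^ 2 * angTrace Φ t r ω - 2 * r * jet1 Φ t r ω (0, ω))
    + r ^ 2 * (dangSq Φ t r ω (1, 0) / 2)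
    + r ^ (γ - 1) * (r ^ 3 * ((dangSq Φ t r ω (1, 0) + dangSq Φ t r ω (0, ω)) / 2)
      + 2 * r ^ 2 * angSq Φ t r ω)

lemma jet1_zero_smul (t r c : ℝ) (ω x : E3) :
    jet1 Φ t r ω (0, c • x) = c * jet1 Φ t r ω (0, x) := by
  have : ((0 : ℝ), c • x) = c • ((0 : ℝ), x) := by simp
  rw [jet1, this, map_smul]; rfl

/-- The multiplier `φ_t + r^(γ-1) L(rφ)`. -/
def angMult (Φ : ℝ × E3 → ℝ) (γ t r : ℝ) (x : E3) : ℝ :=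
  jet1 Φ t r x (1, 0) + r ^ (γ - 1) *
    (r * (jet1 Φ t r x (1, 0) + jet1 Φ t r x (0, x)) + Φ (t, r • x))

/-- The function whose `k`-th angular derivatives sum up to `angFlux`. -/
def angPot (Φ : ℝ × E3 → ℝ) (γ t r : ℝ) (k : Fin 3) (x : E3) : ℝ :=
  angMult Φ γ t r x * (r * jet1 Φ t r x (0, rotGen k x))

lemma contDiff_angPot (hΦ : ContDiff ℝ 2 Φ) (γ t r : ℝ) (k : Fin 3) :
    ContDiff ℝ 1 (angPot Φ γ t r k) := by
  have hD : ContDiff ℝ 1 (fderiv ℝ Φ) := hΦ.fderiv_right (by norm_num)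
  have hk : ContDiff ℝ 1 (rotGen k) := by
    unfold rotGen
    fun_prop
  have hΦ1 : ContDiff ℝ 1 Φ := hΦ.of_le (by norm_num)
  have hb : ContDiff ℝ 1 (fun x : E3 => (t, r • x)) := by fun_prop
  have h0 := hΦ1.comp hb
  have h1 := hD.comp hb
  have ha : ContDiff ℝ 1 (fun x : E3 => jet1 Φ t r x (1, 0)) :=
    h1.clm_apply (contDiff_const (c := ((1 : ℝ), (0 : E3))))
  have hbb : ContDiff ℝ 1 (fun x : E3 => jet1 Φ t r x (0, x)) :=
    h1.clm_apply (contDiff_const.prodMk contDiff_id)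
  have hg : ContDiff ℝ 1 (fun x : E3 => jet1 Φ t r x (0, rotGen k x)) :=
    h1.clm_apply (contDiff_const.prodMk hk)
  exact (ha.add (contDiff_const.mul ((contDiff_const.mul (ha.add hbb)).add h0))).mul
    (contDiff_const.mul hg)

lemma rotFun_zero (k : Fin 3) (x : E3) : rotFun k 0 x = x := by
  ext j; fin_cases k <;> fin_cases j <;> simp [rotFun, bvec]

lemma hasDerivAt_rotFun_zero (k : Fin 3) (x : E3) :
    HasDerivAt (fun s : ℝ => rotFun k s x) (rotGen k x) 0 := by
  have := hasDerivAt_rotFun k 0 x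
  rwa [rotFun_zero] at this

lemma hasDerivAt_rotGen_rotFun_zero (k : Fin 3) (x : E3) :
    HasDerivAt (fun s : ℝ => rotGen k (rotFun k s x)) (rotGen k (rotGen k x)) 0 := by
  have hp : ∀ i, HasDerivAt (fun s : ℝ => rotFun k s x i) (rotGen k x i) 0 := fun i =>
    (EuclideanSpace.proj (𝕜 := ℝ) i).hasFDerivAt.comp_hasDerivAt (0 : ℝ)
      (hasDerivAt_rotFun_zero k x)
  exact ((hp (k + 1)).smul_const _).sub ((hp (k + 2)).smul_const _)

lemma hasDerivAt_jet0_rotFun (hΦ : ContDiff ℝ 2 Φ) (t r : ℝ) (k : Fin 3) (x : E3) :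
    HasDerivAt (fun s : ℝ => Φ (t, r • rotFun k s x)) (r * jet1 Φ t r x (0, rotGen k x)) 0 := by
  have hpt : HasDerivAt (fun s : ℝ => (t, r • rotFun k s x)) ((0 : ℝ), r • rotGen k x) 0 :=
    (hasDerivAt_const _ _).prodMk ((hasDerivAt_rotFun_zero k x).const_smul r)
  have := ((hΦ.differentiable (by norm_num))
    (t, r • rotFun k 0 x)).hasFDerivAt.comp_hasDerivAt (0 : ℝ) hpt
  refine this.congr_deriv ?_
  rw [rotFun_zero, ← jet1_zero_smul]; rfl

lemma hasDerivAt_jet1_rotFun (hΦ : ContDiff ℝ 2 Φ) (t r : ℝ) (k : Fin 3) (x : E3)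
    {v : ℝ → ℝ × E3} {v' : ℝ × E3} (hv : HasDerivAt v v' 0) :
    HasDerivAt (fun s : ℝ => jet1 Φ t r (rotFun k s x) (v s))
      (r * jet2 Φ t r x (0, rotGen k x) (v 0) + jet1 Φ t r x v') 0 := by
  have hD : ContDiff ℝ 1 (fderiv ℝ Φ) := hΦ.fderiv_right (by norm_num)
  have hpt : HasDerivAt (fun s : ℝ => (t, r • rotFun k s x)) ((0 : ℝ), r • rotGen k x) 0 :=
    (hasDerivAt_const _ _).prodMk ((hasDerivAt_rotFun_zero k x).const_smul r)
  have h := ((hD.differentiable (by norm_num))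
    (t, r • rotFun k 0 x)).hasFDerivAt.comp_hasDerivAt (0 : ℝ) hpt
  have e : ((0 : ℝ), r • rotGen k x) = r • ((0 : ℝ), rotGen k x) := by simp
  rw [rotFun_zero, e, map_smul] at h
  refine (h.clm_apply hv).congr_deriv ?_
  simp [jet1, jet2, rotFun_zero]

lemma fderiv_angPot (hΦ : ContDiff ℝ 2 Φ) (γ t r : ℝ) (k : Fin 3) (x : E3) :
    fderiv ℝ (angPot Φ γ t r k) x (rotGen k x)
      = (r * jet2 Φ t r x (1, 0) (0, rotGen k x) + r ^ (γ - 1) *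
          (r * (r * jet2 Φ t r x (1, 0) (0, rotGen k x) + (r * jet2 Φ t r x (0, x) (0, rotGen k x)
            + jet1 Φ t r x (0, rotGen k x))) + r * jet1 Φ t r x (0, rotGen k x)))
          * (r * jet1 Φ t r x (0, rotGen k x))
        + angMult Φ γ t r x * (r * (r * jet2 Φ t r x (0, rotGen k x) (0, rotGen k x)
            + jet1 Φ t r x (0, rotGen k (rotGen k x)))) := by
  have e0 := hasDerivAt_jet0_rotFun hΦ t r k x
  have ea := hasDerivAt_jet1_rotFun hΦ t r k x (hasDerivAt_const (0 : ℝ) ((1 : ℝ), (0 : E3)))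
  have eb := hasDerivAt_jet1_rotFun hΦ t r k x
    ((hasDerivAt_const (0 : ℝ) (0 : ℝ)).prodMk (hasDerivAt_rotFun_zero k x))
  have eg := hasDerivAt_jet1_rotFun hΦ t r k x
    ((hasDerivAt_const (0 : ℝ) (0 : ℝ)).prodMk (hasDerivAt_rotGen_rotFun_zero k x))
  have em := (ea.add (((ea.add eb).const_mul r |>.add e0).const_mul (r ^ (γ - 1)))).mul
    (eg.const_mul r)
  have hchain : HasDerivAt (fun s : ℝ => angPot Φ γ t r k (rotFun k s x))
      (fderiv ℝ (angPot Φ γ t r k) x (rotGen k x)) 0 := by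
    have h1 := ((contDiff_angPot hΦ γ t r k).differentiable (by norm_num)
      (rotFun k 0 x)).hasFDerivAt.comp_hasDerivAt (0 : ℝ) (hasDerivAt_rotFun_zero k x)
    rw [rotFun_zero] at h1
    exact h1
  refine hchain.unique (em.congr_deriv ?_)
  have hz : jet1 Φ t r x 0 = 0 := by simp [jet1]
  have hs1 := jet2_symm hΦ t r x (0, rotGen k x) (1, 0)
  have hs2 := jet2_symm hΦ t r x (0, rotGen k x) (0, x)
  simp only [rotFun_zero, Pi.add_apply, hz, hs1, hs2, angMult]
  ring

/-- The angular divergence integrates to zero over the sphere. -/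
lemma integral_angFlux (hΦ : ContDiff ℝ 2 Φ) (γ t r : ℝ) :
    ∫ ω : Metric.sphere (0 : E3) 1, angFlux Φ γ t r ω ∂sphereMeasure = 0 := by
  have hsum : ∀ x : E3, angFlux Φ γ t r x
      = ∑ k, fderiv ℝ (angPot Φ γ t r k) x (rotGen k x) := by
    intro x
    have htr : ∑ k, jet1 Φ t r x (0, rotGen k (rotGen k x)) = -2 * jet1 Φ t r x (0, x) := by
      rw [← jet1_zero_smul, ← sum_rotGen_rotGen]
      have : ((0 : ℝ), ∑ k, rotGen k (rotGen k x)) = ∑ k, ((0 : ℝ), rotGen k (rotGen k x)) := by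
        simp [Fin.sum_univ_three]
      rw [this, jet1, map_sum]; rfl
    simp only [fderiv_angPot hΦ, angFlux, angTrace, angSq, dangSq, angMult]
    simp only [Fin.sum_univ_three] at htr ⊢
    linear_combination -(r * (jet1 Φ t r x (1, 0) + r ^ (γ - 1) *
      (r * (jet1 Φ t r x (1, 0) + jet1 Φ t r x (0, x)) + Φ (t, r • x)))) * htr
  simp only [hsum]
  rw [integral_finsetSum]
  · exact Finset.sum_eq_zero fun k _ => integral_sphere_rotGen k (contDiff_angPot hΦ γ t r k)
  · intro k _
    have : Continuous fun ω : Metric.sphere (0 : E3) 1 =>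
        fderiv ℝ (angPot Φ γ t r k) (ω : E3) (rotGen k (ω : E3)) :=
      (((contDiff_angPot hΦ γ t r k).continuous_fderiv (by norm_num)).clm_apply
        (continuous_rotGen k)).comp continuous_subtype_val
    exact this.integrable_of_hasCompactSupport (HasCompactSupport.of_compactSpace _)

end Jets

lemma intervalIntegral_sphere_swap {F : ℝ → Metric.sphere (0 : E3) 1 → ℝ}
    (hF : Continuous (Function.uncurry F)) (a b : ℝ) :
    ∫ t in a..b, ∫ ω, F t ω ∂sphereMeasure = ∫ ω, (∫ t in a..b, F t ω) ∂sphereMeasure := by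
  refine intervalIntegral_integral_swap ?_
  rw [← Measure.restrict_univ (μ := sphereMeasure), Measure.prod_restrict]
  exact (hF.continuousOn.integrableOn_compact
    (isCompact_uIcc.prod isCompact_univ)).mono_set
      (Set.prod_mono Set.uIoc_subset_uIcc le_rfl)

lemma Continuous.integrable_sphere {h : Metric.sphere (0 : E3) 1 → ℝ} (hh : Continuous h) :
    Integrable h sphereMeasure :=
  hh.integrable_of_hasCompactSupport (HasCompactSupport.of_compactSpace _)

section Field

variable {p γ : ℝ} {Φ : ℝ × E3 → ℝ}

/-- The density `curP` of the field `Φ` at the point `(t, r ω)`. -/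
def fieldP (p γ : ℝ) (Φ : ℝ × E3 → ℝ) (t r : ℝ) (ω : E3) : ℝ :=
  curP p γ r (Φ (t, r • ω)) (jet1 Φ t r ω (1, 0)) (jet1 Φ t r ω (0, ω)) (angSq Φ t r ω)

/-- The flux `curQ` of the field `Φ` at the point `(t, r ω)`. -/
def fieldQ (p γ : ℝ) (Φ : ℝ × E3 → ℝ) (t r : ℝ) (ω : E3) : ℝ :=
  curQ p γ r (Φ (t, r • ω)) (jet1 Φ t r ω (1, 0)) (jet1 Φ t r ω (0, ω)) (angSq Φ t r ω)

/-- Time derivative of `fieldP`. -/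
def dtFieldP (p γ : ℝ) (Φ : ℝ × E3 → ℝ) (t r : ℝ) (ω : E3) : ℝ :=
  dcurP p γ r (Φ (t, r • ω)) (jet1 Φ t r ω (1, 0)) (jet1 Φ t r ω (0, ω)) (angSq Φ t r ω)
    0 (jet1 Φ t r ω (1, 0)) (jet2 Φ t r ω (1, 0) (1, 0)) (jet2 Φ t r ω (1, 0) (0, ω))
    (dangSq Φ t r ω (1, 0))

/-- Radial derivative of `fieldP`. -/
def drFieldP (p γ : ℝ) (Φ : ℝ × E3 → ℝ) (t r : ℝ) (ω : E3) : ℝ :=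
  dcurP p γ r (Φ (t, r • ω)) (jet1 Φ t r ω (1, 0)) (jet1 Φ t r ω (0, ω)) (angSq Φ t r ω)
    1 (jet1 Φ t r ω (0, ω)) (jet2 Φ t r ω (0, ω) (1, 0)) (jet2 Φ t r ω (0, ω) (0, ω))
    (dangSq Φ t r ω (0, ω))

/-- Radial derivative of `fieldQ`. -/
def drFieldQ (p γ : ℝ) (Φ : ℝ × E3 → ℝ) (t r : ℝ) (ω : E3) : ℝ :=
  dcurQ p γ r (Φ (t, r • ω)) (jet1 Φ t r ω (1, 0)) (jet1 Φ t r ω (0, ω)) (angSq Φ t r ω)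
    1 (jet1 Φ t r ω (0, ω)) (jet2 Φ t r ω (0, ω) (1, 0)) (jet2 Φ t r ω (0, ω) (0, ω))
    (dangSq Φ t r ω (0, ω))

lemma hasDerivAt_fieldP (hp : 0 < p) (hγ : 1 ≤ γ) (hΦ : ContDiff ℝ 2 Φ) {t r : ℝ → ℝ}
    {t' r' τ : ℝ} (ω : E3) (ht : HasDerivAt t t' τ) (hr : HasDerivAt r r' τ) :
    HasDerivAt (fun s => fieldP p γ Φ (t s) (r s) ω)
      (t' * dtFieldP p γ Φ (t τ) (r τ) ω + r' * drFieldP p γ Φ (t τ) (r τ) ω) τ := by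
  refine (hasDerivAt_curP hp hγ hr (hasDerivAt_jet0 hΦ ω ht hr) (hasDerivAt_jet1 hΦ ω _ ht hr)
    (hasDerivAt_jet1 hΦ ω _ ht hr) (hasDerivAt_angSq hΦ ω ht hr)).congr_deriv ?_
  simp only [dtFieldP, drFieldP, dcurP]
  ring

lemma hasDerivAt_fieldQ (hp : 0 < p) (hγ : 1 ≤ γ) (hΦ : ContDiff ℝ 2 Φ) {r : ℝ → ℝ}
    {r' τ : ℝ} (t : ℝ) (ω : E3) (hr : HasDerivAt r r' τ) :
    HasDerivAt (fun s => fieldQ p γ Φ t (r s) ω) (r' * drFieldQ p γ Φ t (r τ) ω) τ := by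
  have ht := hasDerivAt_const τ t
  refine (hasDerivAt_curQ hp hγ hr (hasDerivAt_jet0 hΦ ω ht hr) (hasDerivAt_jet1 hΦ ω _ ht hr)
    (hasDerivAt_jet1 hΦ ω _ ht hr) (hasDerivAt_angSq hΦ ω ht hr)).congr_deriv ?_
  simp only [drFieldQ, dcurQ]
  ring

lemma field_divergence_le (hp : 0 < p) (hγ : 1 ≤ γ) (hγ2 : γ ≤ 2) (hγp : γ ≤ p - 1)
    (hΦ : ContDiff ℝ 2 Φ) {t r : ℝ} {ω : E3} (hr : 0 < r)
    (heq : jet2 Φ t r ω (1, 0) (1, 0) - (jet2 Φ t r ω (0, ω) (0, ω) + angTrace Φ t r ω)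
      + |Φ (t, r • ω)| ^ (p - 1) * Φ (t, r • ω) = 0) :
    dtFieldP p γ Φ t r ω + drFieldQ p γ Φ t r ω ≤ angFlux Φ γ t r ω := by
  have h := current_divergence_le (atr := jet2 Φ t r ω (1, 0) (0, ω))
    (Gt := dangSq Φ t r ω (1, 0)) (Gr := dangSq Φ t r ω (0, ω)) (a := jet1 Φ t r ω (1, 0))
    (b := jet1 Φ t r ω (0, ω)) hp hγ hγ2 hγp hr (angSq_nonneg (Φ := Φ) t r ω) heq
  rw [dtFieldP, drFieldQ, jet2_symm hΦ t r ω (0, ω) (1, 0)]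
  exact h

lemma fieldP_nonneg (hp : 0 < p) {t r : ℝ} (hr : 0 ≤ r) (ω : E3) : 0 ≤ fieldP p γ Φ t r ω :=
  curP_nonneg hp hr (angSq_nonneg t r ω)

section Continuity

variable {X : Type*} [TopologicalSpace X] {t r : X → ℝ} {ω : X → E3} {v : X → ℝ × E3}

lemma continuous_angSq (hΦ : ContDiff ℝ 2 Φ) (ht : Continuous t) (hr : Continuous r)
    (hω : Continuous ω) : Continuous (fun x => angSq Φ (t x) (r x) (ω x)) := by
  have := fun k => continuous_rotGen k
  unfold angSq
  fun_prop (disch := assumption)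

lemma continuous_dangSq (hΦ : ContDiff ℝ 2 Φ) (ht : Continuous t) (hr : Continuous r)
    (hω : Continuous ω) (hv : Continuous v) :
    Continuous (fun x => dangSq Φ (t x) (r x) (ω x) (v x)) := by
  have := fun k => continuous_rotGen k
  unfold dangSq
  fun_prop (disch := assumption)

lemma continuous_angTrace (hΦ : ContDiff ℝ 2 Φ) (ht : Continuous t) (hr : Continuous r)
    (hω : Continuous ω) : Continuous (fun x => angTrace Φ (t x) (r x) (ω x)) := by
  have := fun k => continuous_rotGen k
  unfold angTrace
  fun_prop (disch := assumption)

lemma continuous_angFlux (hγ : 1 ≤ γ) (hΦ : ContDiff ℝ 2 Φ) (ht : Continuous t)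
    (hr : Continuous r) (hω : Continuous ω) :
    Continuous (fun x => angFlux Φ γ (t x) (r x) (ω x)) := by
  have h1 := continuous_angSq hΦ ht hr hω
  have h2 := continuous_angTrace hΦ ht hr hω
  have h3 := continuous_dangSq hΦ ht hr hω (continuous_const (y := ((1 : ℝ), (0 : E3))))
  have h4 := continuous_dangSq hΦ ht hr hω ((continuous_const (y := (0 : ℝ))).prodMk hω)
  have h5 : Continuous fun x => r x ^ (γ - 1) := hr.rpow_const fun _ => Or.inr (by linarith)
  have h6 := hΦ.continuous
  unfold angFlux
  fun_prop (disch := assumption)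

variable {f a b G r' f' a' b' G' : X → ℝ}

lemma continuous_curP (hp : 0 < p) (hγ : 1 ≤ γ) (hr : Continuous r) (hf : Continuous f)
    (ha : Continuous a) (hb : Continuous b) (hG : Continuous G) :
    Continuous (fun x => curP p γ (r x) (f x) (a x) (b x) (G x)) := by
  have h1 : Continuous fun x => r x ^ γ := hr.rpow_const fun _ => Or.inr (by linarith)
  have h2 : Continuous fun x => |f x| ^ (p + 1) :=
    hf.abs.rpow_const fun _ => Or.inr (by linarith)
  unfold curP
  fun_prop

lemma continuous_curQ (hp : 0 < p) (hγ : 1 ≤ γ) (hr : Continuous r) (hf : Continuous f)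
    (ha : Continuous a) (hb : Continuous b) (hG : Continuous G) :
    Continuous (fun x => curQ p γ (r x) (f x) (a x) (b x) (G x)) := by
  have h1 : Continuous fun x => r x ^ γ := hr.rpow_const fun _ => Or.inr (by linarith)
  have h2 : Continuous fun x => |f x| ^ (p + 1) :=
    hf.abs.rpow_const fun _ => Or.inr (by linarith)
  unfold curQ
  fun_prop

lemma continuous_dcurP (hp : 1 ≤ p) (hγ : 1 ≤ γ) (hr : Continuous r) (hf : Continuous f)
    (ha : Continuous a) (hb : Continuous b) (hG : Continuous G) (hr' : Continuous r')
    (hf' : Continuous f') (ha' : Continuous a') (hb' : Continuous b') (hG' : Continuous G') :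
    Continuous (fun x => dcurP p γ (r x) (f x) (a x) (b x) (G x)
      (r' x) (f' x) (a' x) (b' x) (G' x)) := by
  have h1 : Continuous fun x => r x ^ γ := hr.rpow_const fun _ => Or.inr (by linarith)
  have h3 : Continuous fun x => r x ^ (γ - 1) := hr.rpow_const fun _ => Or.inr (by linarith)
  have h2 : Continuous fun x => |f x| ^ (p + 1) :=
    hf.abs.rpow_const fun _ => Or.inr (by linarith)
  have h4 : Continuous fun x => |f x| ^ (p - 1) :=
    hf.abs.rpow_const fun _ => Or.inr (by linarith)
  unfold dcurP
  fun_prop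

lemma continuous_dcurQ (hp : 1 ≤ p) (hγ : 1 ≤ γ) (hr : Continuous r) (hf : Continuous f)
    (ha : Continuous a) (hb : Continuous b) (hG : Continuous G) (hr' : Continuous r')
    (hf' : Continuous f') (ha' : Continuous a') (hb' : Continuous b') (hG' : Continuous G') :
    Continuous (fun x => dcurQ p γ (r x) (f x) (a x) (b x) (G x)
      (r' x) (f' x) (a' x) (b' x) (G' x)) := by
  have h1 : Continuous fun x => r x ^ γ := hr.rpow_const fun _ => Or.inr (by linarith)
  have h3 : Continuous fun x => r x ^ (γ - 1) := hr.rpow_const fun _ => Or.inr (by linarith)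
  have h2 : Continuous fun x => |f x| ^ (p + 1) :=
    hf.abs.rpow_const fun _ => Or.inr (by linarith)
  have h4 : Continuous fun x => |f x| ^ (p - 1) :=
    hf.abs.rpow_const fun _ => Or.inr (by linarith)
  unfold dcurQ
  fun_prop

lemma continuous_field (hΦ : ContDiff ℝ 2 Φ) (ht : Continuous t) (hr : Continuous r)
    (hω : Continuous ω) : Continuous (fun x => Φ (t x, r x • ω x)) :=
  hΦ.continuous.comp (ht.prodMk (hr.smul hω))

lemma continuous_fieldP (hp : 0 < p) (hγ : 1 ≤ γ) (hΦ : ContDiff ℝ 2 Φ) (ht : Continuous t)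
    (hr : Continuous r) (hω : Continuous ω) :
    Continuous (fun x => fieldP p γ Φ (t x) (r x) (ω x)) :=
  continuous_curP hp hγ hr (continuous_field hΦ ht hr hω)
    (continuous_jet1 hΦ ht hr hω continuous_const)
    (continuous_jet1 hΦ ht hr hω (continuous_const.prodMk hω)) (continuous_angSq hΦ ht hr hω)

lemma continuous_fieldQ (hp : 0 < p) (hγ : 1 ≤ γ) (hΦ : ContDiff ℝ 2 Φ) (ht : Continuous t)
    (hr : Continuous r) (hω : Continuous ω) :
    Continuous (fun x => fieldQ p γ Φ (t x) (r x) (ω x)) :=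
  continuous_curQ hp hγ hr (continuous_field hΦ ht hr hω)
    (continuous_jet1 hΦ ht hr hω continuous_const)
    (continuous_jet1 hΦ ht hr hω (continuous_const.prodMk hω)) (continuous_angSq hΦ ht hr hω)

lemma continuous_dtFieldP (hp : 1 ≤ p) (hγ : 1 ≤ γ) (hΦ : ContDiff ℝ 2 Φ) (ht : Continuous t)
    (hr : Continuous r) (hω : Continuous ω) :
    Continuous (fun x => dtFieldP p γ Φ (t x) (r x) (ω x)) := by
  have h0 : Continuous fun _ : X => ((1 : ℝ), (0 : E3)) := continuous_const
  have h1 : Continuous fun x => ((0 : ℝ), ω x) := continuous_const.prodMk hω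
  exact continuous_dcurP hp hγ hr (continuous_field hΦ ht hr hω) (continuous_jet1 hΦ ht hr hω h0)
    (continuous_jet1 hΦ ht hr hω h1) (continuous_angSq hΦ ht hr hω) continuous_const
    (continuous_jet1 hΦ ht hr hω h0) (continuous_jet2 hΦ ht hr hω h0 h0)
    (continuous_jet2 hΦ ht hr hω h0 h1) (continuous_dangSq hΦ ht hr hω h0)

lemma continuous_drFieldP (hp : 1 ≤ p) (hγ : 1 ≤ γ) (hΦ : ContDiff ℝ 2 Φ) (ht : Continuous t)
    (hr : Continuous r) (hω : Continuous ω) :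
    Continuous (fun x => drFieldP p γ Φ (t x) (r x) (ω x)) := by
  have h0 : Continuous fun _ : X => ((1 : ℝ), (0 : E3)) := continuous_const
  have h1 : Continuous fun x => ((0 : ℝ), ω x) := continuous_const.prodMk hω
  exact continuous_dcurP hp hγ hr (continuous_field hΦ ht hr hω) (continuous_jet1 hΦ ht hr hω h0)
    (continuous_jet1 hΦ ht hr hω h1) (continuous_angSq hΦ ht hr hω) continuous_const
    (continuous_jet1 hΦ ht hr hω h1) (continuous_jet2 hΦ ht hr hω h1 h0)
    (continuous_jet2 hΦ ht hr hω h1 h1) (continuous_dangSq hΦ ht hr hω h1)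

lemma continuous_drFieldQ (hp : 1 ≤ p) (hγ : 1 ≤ γ) (hΦ : ContDiff ℝ 2 Φ) (ht : Continuous t)
    (hr : Continuous r) (hω : Continuous ω) :
    Continuous (fun x => drFieldQ p γ Φ (t x) (r x) (ω x)) := by
  have h0 : Continuous fun _ : X => ((1 : ℝ), (0 : E3)) := continuous_const
  have h1 : Continuous fun x => ((0 : ℝ), ω x) := continuous_const.prodMk hω
  exact continuous_dcurQ hp hγ hr (continuous_field hΦ ht hr hω) (continuous_jet1 hΦ ht hr hω h0)
    (continuous_jet1 hΦ ht hr hω h1) (continuous_angSq hΦ ht hr hω) continuous_const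
    (continuous_jet1 hΦ ht hr hω h1) (continuous_jet2 hΦ ht hr hω h1 h0)
    (continuous_jet2 hΦ ht hr hω h1 h1) (continuous_dangSq hΦ ht hr hω h1)

end Continuity

/-- For each direction `ω`, the flux through the curve `r = ρ t` up to time `T` is controlled by
the initial density on `[ρ 0, T + ρ T]` and the angular divergence. -/
lemma radial_flux_le (hp : 1 ≤ p) (hγ : 1 ≤ γ) (hγ2 : γ ≤ 2) (hγp : γ ≤ p - 1)
    (hΦ : ContDiff ℝ 2 Φ) {ω : E3}
    (heq : ∀ t, 0 ≤ t → ∀ r, jet2 Φ t r ω (1, 0) (1, 0)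
      - (jet2 Φ t r ω (0, ω) (0, ω) + angTrace Φ t r ω)
      + |Φ (t, r • ω)| ^ (p - 1) * Φ (t, r • ω) = 0)
    {ρ ρ' : ℝ → ℝ} {T : ℝ} (hT : 0 ≤ T) (cρ : Continuous ρ) (cρ' : Continuous ρ')
    (hρ : ∀ t, 0 ≤ t → HasDerivAt ρ (ρ' t) t) (hpos : ∀ t, 0 ≤ t → 0 < ρ t)
    (hle : ∀ t ∈ Set.Icc 0 T, t + ρ t ≤ T + ρ T) :
    ∫ t in (0 : ℝ)..T, (ρ' t * fieldP p γ Φ t (ρ t) ω - fieldQ p γ Φ t (ρ t) ω)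
      ≤ (∫ r in (ρ 0)..(T + ρ T), fieldP p γ Φ 0 r ω)
        + ∫ t in (0 : ℝ)..T, ∫ s in (0 : ℝ)..1,
          (T + ρ T - t - ρ t) * angFlux Φ γ t (ρ t + (T + ρ T - t - ρ t) * s) ω := by
  have hp0 : 0 < p := by linarith
  set R := T + ρ T with hR
  set rr : ℝ → ℝ → ℝ := fun t s => ρ t + (R - t - ρ t) * s with hrr
  set rt : ℝ → ℝ → ℝ := fun t s => ρ' t + (-1 - ρ' t) * s with hrt
  set Ut : ℝ → ℝ → ℝ := fun t s =>
    (dtFieldP p γ Φ t (rr t s) ω + rt t s * drFieldP p γ Φ t (rr t s) ω) * (R - t - ρ t)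
      + fieldP p γ Φ t (rr t s) ω * (-1 - ρ' t) with hUt
  set Vs : ℝ → ℝ → ℝ := fun t s =>
    (R - t - ρ t) * drFieldQ p γ Φ t (rr t s) ω - ((-1 - ρ' t) * fieldP p γ Φ t (rr t s) ω
      + rt t s * ((R - t - ρ t) * drFieldP p γ Φ t (rr t s) ω)) with hVs
  have c1 : Continuous fun q : ℝ × ℝ => q.1 := continuous_fst
  have c2 : Continuous fun q : ℝ × ℝ => rr q.1 q.2 := by fun_prop
  have c3 : Continuous fun q : ℝ × ℝ => rt q.1 q.2 := by fun_prop
  have c4 : Continuous fun _ : ℝ × ℝ => ω := continuous_const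
  have cP := continuous_fieldP hp0 hγ hΦ c1 c2 c4
  have cPt := continuous_dtFieldP hp hγ hΦ c1 c2 c4
  have cPr := continuous_drFieldP hp hγ hΦ c1 c2 c4
  have cQr := continuous_drFieldQ hp hγ hΦ c1 c2 c4
  have cF := continuous_angFlux hγ hΦ c1 c2 c4
  have cUt : Continuous (Function.uncurry Ut) := by
    simp only [hUt, Function.uncurry_def]; fun_prop
  have cVs : Continuous (Function.uncurry Vs) := by
    simp only [hVs, Function.uncurry_def]; fun_prop
  have key := rect_divergence (U := fun t s => fieldP p γ Φ t (rr t s) ω * (R - t - ρ t))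
    (V := fun t s => fieldQ p γ Φ t (rr t s) ω - rt t s * fieldP p γ Φ t (rr t s) ω)
    hT cUt cVs (fun t ht s _ => by
      have hd : HasDerivAt (fun τ => R - τ - ρ τ) (-1 - ρ' t) t :=
        ((hasDerivAt_id t).const_sub R).sub (hρ t ht.1)
      have hr : HasDerivAt (fun τ => rr τ s) (rt t s) t :=
        (hρ t ht.1).add (hd.mul_const s)
      refine ((hasDerivAt_fieldP hp0 hγ hΦ ω (hasDerivAt_id t) hr).mul hd).congr_deriv ?_
      simp only [hUt, id]; ring)
    (fun t ht s _ => by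
      have hr : HasDerivAt (fun σ => rr t σ) (R - t - ρ t) s :=
        (((hasDerivAt_id s).const_mul (R - t - ρ t)).const_add (ρ t)).congr_deriv (mul_one _)
      have hrt' : HasDerivAt (fun σ => rt t σ) (-1 - ρ' t) s :=
        (((hasDerivAt_id s).const_mul (-1 - ρ' t)).const_add (ρ' t)).congr_deriv (mul_one _)
      refine ((hasDerivAt_fieldQ hp0 hγ hΦ t ω hr).sub (hrt'.mul
        (hasDerivAt_fieldP hp0 hγ hΦ ω (hasDerivAt_const s t) hr))).congr_deriv ?_
      simp only [hVs]; ring)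
  have hbulk : ∫ t in (0 : ℝ)..T, ∫ s in (0 : ℝ)..1, (Ut t s + Vs t s)
      ≤ ∫ t in (0 : ℝ)..T, ∫ s in (0 : ℝ)..1, (R - t - ρ t) * angFlux Φ γ t (rr t s) ω := by
    have cS : Continuous (Function.uncurry fun t s => Ut t s + Vs t s) := cUt.add cVs
    have cA : Continuous (Function.uncurry fun t s =>
        (R - t - ρ t) * angFlux Φ γ t (rr t s) ω) := by
      simp only [Function.uncurry_def]; fun_prop
    refine intervalIntegral.integral_mono_on hT
      ((intervalIntegral.continuous_parametric_intervalIntegral_of_continuous' cS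
        0 1).intervalIntegrable _ _)
      ((intervalIntegral.continuous_parametric_intervalIntegral_of_continuous' cA
        0 1).intervalIntegrable _ _) fun t ht => ?_
    refine intervalIntegral.integral_mono_on zero_le_one
      ((cS.comp (by fun_prop : Continuous fun s => (t, s))).intervalIntegrable _ _)
      ((cA.comp (by fun_prop : Continuous fun s => (t, s))).intervalIntegrable _ _) fun s hs => ?_
    have hd : 0 ≤ R - t - ρ t := by linarith [hle t ht]
    have hr : 0 < rr t s := by
      have := hpos t ht.1
      have := mul_nonneg hd hs.1
      simp only [hrr]; linarith
    have := mul_le_mul_of_nonneg_left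
      (field_divergence_le hp0 hγ hγ2 hγp hΦ hr (heq t ht.1 (rr t s))) hd
    refine le_trans (le_of_eq ?_) this
    simp only [hUt, hVs]; ring
  rw [key] at hbulk
  have hU0 : ∫ s in (0 : ℝ)..1, fieldP p γ Φ 0 (rr 0 s) ω * (R - 0 - ρ 0)
      = ∫ r in (ρ 0)..R, fieldP p γ Φ 0 r ω := by
    have h := intervalIntegral.smul_integral_comp_add_mul (a := 0) (b := 1)
      (fun r => fieldP p γ Φ 0 r ω) (R - 0 - ρ 0) (ρ 0)
    rw [smul_eq_mul, ← intervalIntegral.integral_const_mul] at h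
    simp only [mul_zero, add_zero, mul_one] at h
    rw [show ρ 0 + (R - 0 - ρ 0) = R by ring] at h
    rw [← h]
    exact intervalIntegral.integral_congr fun s _ => mul_comm _ _
  have hU : -(∫ r in (ρ 0)..R, fieldP p γ Φ 0 r ω)
      ≤ ∫ s in (0 : ℝ)..1, (fieldP p γ Φ T (rr T s) ω * (R - T - ρ T)
        - fieldP p γ Φ 0 (rr 0 s) ω * (R - 0 - ρ 0)) := by
    rw [← hU0, ← intervalIntegral.integral_neg]
    have h0 : R - T - ρ T = 0 := by rw [hR]; ring
    simp [h0]
  have hV : ∫ t in (0 : ℝ)..T, (ρ' t * fieldP p γ Φ t (ρ t) ω - fieldQ p γ Φ t (ρ t) ω)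
      ≤ ∫ t in (0 : ℝ)..T, ((fieldQ p γ Φ t (rr t 1) ω - rt t 1 * fieldP p γ Φ t (rr t 1) ω)
        - (fieldQ p γ Φ t (rr t 0) ω - rt t 0 * fieldP p γ Φ t (rr t 0) ω)) := by
    have cω : Continuous fun _ : ℝ => ω := continuous_const
    have e1 := fun s => continuous_fieldP (t := fun t => t) (r := fun t => rr t s) (ω := fun _ => ω)
      hp0 hγ hΦ continuous_id (by fun_prop) cω
    have e2 := fun s => continuous_fieldQ (t := fun t => t) (r := fun t => rr t s) (ω := fun _ => ω)
      hp0 hγ hΦ continuous_id (by fun_prop) cω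
    have e3 := continuous_fieldP (t := fun t => t) (r := ρ) (ω := fun _ => ω)
      hp0 hγ hΦ continuous_id cρ cω
    have e4 := continuous_fieldQ (t := fun t => t) (r := ρ) (ω := fun _ => ω)
      hp0 hγ hΦ continuous_id cρ cω
    refine intervalIntegral.integral_mono_on hT
      (Continuous.intervalIntegrable (by fun_prop) _ _)
      (Continuous.intervalIntegrable (by fun_prop) _ _) fun t ht => ?_
    have hr : 0 ≤ rr t 1 := by
      have := hpos t ht.1
      have := hle t ht
      simp only [hrr]; linarith
    have h1 : 0 ≤ fieldQ p γ Φ t (rr t 1) ω + fieldP p γ Φ t (rr t 1) ω :=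
      curP_add_curQ_nonneg hp0 hr (angSq_nonneg t _ ω)
    have e : rr t 0 = ρ t := by simp [hrr]
    have e' : rt t 0 = ρ' t := by simp [hrt]
    have e'' : rt t 1 = -1 := by simp only [hrt]; ring
    rw [e, e', e'']
    linarith
  linarith

end Field

section IntegratedFlux

variable {p γ : ℝ} {Φ : ℝ × E3 → ℝ}

/-- The flux through the surface `r = ρ t`, `0 ≤ t ≤ T`, is bounded by the initial density. -/
lemma integrated_flux_le (hp : 1 ≤ p) (hγ : 1 ≤ γ) (hγ2 : γ ≤ 2) (hγp : γ ≤ p - 1)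
    (hΦ : ContDiff ℝ 2 Φ)
    (heq : ∀ ω : E3, ‖ω‖ = 1 → ∀ t, 0 ≤ t → ∀ r, jet2 Φ t r ω (1, 0) (1, 0)
      - (jet2 Φ t r ω (0, ω) (0, ω) + angTrace Φ t r ω)
      + |Φ (t, r • ω)| ^ (p - 1) * Φ (t, r • ω) = 0)
    {ρ ρ' : ℝ → ℝ} {T : ℝ} (hT : 0 ≤ T) (cρ : Continuous ρ) (cρ' : Continuous ρ')
    (hρ : ∀ t, 0 ≤ t → HasDerivAt ρ (ρ' t) t) (hpos : ∀ t, 0 ≤ t → 0 < ρ t)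
    (hle : ∀ t ∈ Set.Icc 0 T, t + ρ t ≤ T + ρ T) :
    ∫ ω : Metric.sphere (0 : E3) 1,
        (∫ t in (0 : ℝ)..T, (ρ' t * fieldP p γ Φ t (ρ t) ω - fieldQ p γ Φ t (ρ t) ω))
        ∂sphereMeasure
      ≤ ∫ ω : Metric.sphere (0 : E3) 1,
          (∫ r in (ρ 0)..(T + ρ T), fieldP p γ Φ 0 r ω) ∂sphereMeasure := by
  have hp0 : 0 < p := by linarith
  have cflux : Continuous (Function.uncurry fun (ω : Metric.sphere (0 : E3) 1) (t : ℝ) =>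
      ρ' t * fieldP p γ Φ t (ρ t) ω - fieldQ p γ Φ t (ρ t) ω) := by
    have e1 := continuous_fieldP (X := Metric.sphere (0 : E3) 1 × ℝ) (t := fun q => q.2)
      (r := fun q => ρ q.2) (ω := fun q => (q.1 : E3)) hp0 hγ hΦ
      (by fun_prop) (by fun_prop) (by fun_prop)
    have e2 := continuous_fieldQ (X := Metric.sphere (0 : E3) 1 × ℝ) (t := fun q => q.2)
      (r := fun q => ρ q.2) (ω := fun q => (q.1 : E3)) hp0 hγ hΦ
      (by fun_prop) (by fun_prop) (by fun_prop)
    simp only [Function.uncurry_def]; fun_prop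
  have cinit : Continuous (Function.uncurry fun (ω : Metric.sphere (0 : E3) 1) (r : ℝ) =>
      fieldP p γ Φ 0 r ω) :=
    continuous_fieldP (X := Metric.sphere (0 : E3) 1 × ℝ) (t := fun _ => 0) (r := fun q => q.2)
      (ω := fun q => (q.1 : E3)) hp0 hγ hΦ (by fun_prop) (by fun_prop) (by fun_prop)
  have cang : Continuous fun q : (ℝ × Metric.sphere (0 : E3) 1) × ℝ => (T + ρ T - q.1.1 - ρ q.1.1)
      * angFlux Φ γ q.1.1 (ρ q.1.1 + (T + ρ T - q.1.1 - ρ q.1.1) * q.2) (q.1.2 : E3) := by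
    have e := continuous_angFlux (X := (ℝ × Metric.sphere (0 : E3) 1) × ℝ) (t := fun q => q.1.1)
      (r := fun q => ρ q.1.1 + (T + ρ T - q.1.1 - ρ q.1.1) * q.2)
      (ω := fun q => (q.1.2 : E3)) hγ hΦ (by fun_prop) (by fun_prop) (by fun_prop)
    fun_prop
  have cang1 : Continuous (Function.uncurry fun (t : ℝ) (ω : Metric.sphere (0 : E3) 1) =>
      ∫ s in (0 : ℝ)..1,
        (T + ρ T - t - ρ t) * angFlux Φ γ t (ρ t + (T + ρ T - t - ρ t) * s) (ω : E3)) :=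
    intervalIntegral.continuous_parametric_intervalIntegral_of_continuous'
      (f := fun (q : ℝ × Metric.sphere (0 : E3) 1) (s : ℝ) => (T + ρ T - q.1 - ρ q.1)
        * angFlux Φ γ q.1 (ρ q.1 + (T + ρ T - q.1 - ρ q.1) * s) (q.2 : E3)) cang 0 1
  have cang2 : Continuous (Function.uncurry fun (ω : Metric.sphere (0 : E3) 1) (t : ℝ) =>
      ∫ s in (0 : ℝ)..1,
        (T + ρ T - t - ρ t) * angFlux Φ γ t (ρ t + (T + ρ T - t - ρ t) * s) (ω : E3)) :=
    cang1.comp continuous_swap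
  have hzero : ∫ ω : Metric.sphere (0 : E3) 1, (∫ t in (0 : ℝ)..T, ∫ s in (0 : ℝ)..1,
      (T + ρ T - t - ρ t) * angFlux Φ γ t (ρ t + (T + ρ T - t - ρ t) * s) (ω : E3))
      ∂sphereMeasure = 0 := by
    rw [← intervalIntegral_sphere_swap cang1]
    have : ∀ t : ℝ, ∫ ω : Metric.sphere (0 : E3) 1, (∫ s in (0 : ℝ)..1, (T + ρ T - t - ρ t)
        * angFlux Φ γ t (ρ t + (T + ρ T - t - ρ t) * s) (ω : E3)) ∂sphereMeasure = 0 := by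
      intro t
      rw [← intervalIntegral_sphere_swap (F := fun s (ω : Metric.sphere (0 : E3) 1) =>
        (T + ρ T - t - ρ t) * angFlux Φ γ t (ρ t + (T + ρ T - t - ρ t) * s) (ω : E3))
        (cang.comp (by fun_prop : Continuous fun q : ℝ × Metric.sphere (0 : E3) 1 =>
          ((t, q.2), q.1)))]
      simp [integral_const_mul, integral_angFlux hΦ]
    simp only [this, intervalIntegral.integral_zero]
  have ci := (intervalIntegral.continuous_parametric_intervalIntegral_of_continuous'
    (μ := volume) cinit (ρ 0) (T + ρ T)).integrable_sphere
  have ca := (intervalIntegral.continuous_parametric_intervalIntegral_of_continuous'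
    (μ := volume) cang2 0 T).integrable_sphere
  have cf := (intervalIntegral.continuous_parametric_intervalIntegral_of_continuous'
    (μ := volume) cflux 0 T).integrable_sphere
  have hmono := integral_mono cf (ci.add ca) fun ω =>
      radial_flux_le hp hγ hγ2 hγp hΦ (heq ω (by simp)) hT cρ cρ' hρ hpos hle
  simp only [Pi.add_apply] at hmono
  rwa [integral_add ci ca, hzero, add_zero] at hmono

end IntegratedFlux

section Hyperboloid

lemma continuous_hypRho : Continuous hypRho := by
  unfold hypRho; fun_prop

lemma hypRho_sq {t : ℝ} (ht : 0 ≤ t) : hypRho t ^ 2 = (t + 12 / 5) ^ 2 - 9 / 25 := by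
  rw [hypRho, sq_sqrt (by nlinarith)]; ring

lemma two_le_hypRho {t : ℝ} (ht : 0 ≤ t) : 2 ≤ hypRho t := by
  have h := hypRho_sq ht
  have h0 : 0 ≤ hypRho t := sqrt_nonneg _
  nlinarith

/-- Derivative of `hypRho` at nonnegative times, extended continuously. -/
def hypRho' (t : ℝ) : ℝ := (t + 12 / 5) / max (hypRho t) 1

lemma continuous_hypRho' : Continuous hypRho' := by
  have h := continuous_hypRho
  unfold hypRho'
  exact Continuous.div (by fun_prop) (by fun_prop)
    fun t => (lt_of_lt_of_le one_pos (le_max_right _ _)).ne'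

lemma hypRho'_mul {t : ℝ} (ht : 0 ≤ t) : hypRho' t * hypRho t = t + 12 / 5 := by
  have h := two_le_hypRho ht
  rw [hypRho', max_eq_left (by linarith)]
  field_simp

lemma hasDerivAt_hypRho {t : ℝ} (ht : 0 ≤ t) : HasDerivAt hypRho (hypRho' t) t := by
  have h2 := two_le_hypRho ht
  have hd : HasDerivAt (fun t : ℝ => (t + 3) ^ 2 - (6 / 5) * (t + 3)) (2 * (t + 12 / 5)) t := by
    have h1 := (hasDerivAt_id t).add_const (3 : ℝ)
    refine ((h1.pow 2).sub (h1.const_mul (6 / 5))).congr_deriv ?_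
    simp; ring
  have hne : (t + 3) ^ 2 - (6 / 5) * (t + 3) ≠ 0 := by nlinarith
  refine (hd.sqrt hne).congr_deriv ?_
  rw [hypRho', max_eq_left (by linarith)]
  exact mul_div_mul_left _ _ two_ne_zero

lemma one_le_hypRho' {t : ℝ} (ht : 0 ≤ t) : 1 ≤ hypRho' t := by
  have h1 := hypRho'_mul ht
  have h2 := hypRho_sq ht
  have h3 := two_le_hypRho ht
  have h4 : hypRho t ≤ t + 12 / 5 := by nlinarith
  by_contra! h
  nlinarith

lemma hypRho'_sub_one_mul_sq {t : ℝ} (ht : 0 ≤ t) :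
    3 / 25 ≤ (hypRho' t - 1) * hypRho t ^ 2 := by
  have h1 := hypRho'_mul ht
  have h2 := hypRho_sq ht
  have h3 := two_le_hypRho ht
  have h4 : (hypRho' t - 1) * hypRho t ^ 2 = (t + 12 / 5 - hypRho t) * hypRho t := by
    rw [← h1]; ring
  rw [h4]
  have h5 : (t + 12 / 5 - hypRho t) * (t + 12 / 5 + hypRho t) = 9 / 25 := by linarith
  have h6 : 0 ≤ t + 12 / 5 - hypRho t := by
    by_contra! h
    nlinarith
  have h7 : t + 12 / 5 ≤ 2 * hypRho t := by nlinarith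
  nlinarith

lemma hypRho_mono {s t : ℝ} (hs : 0 ≤ s) (hst : s ≤ t) : hypRho s ≤ hypRho t :=
  sqrt_le_sqrt (by nlinarith)

end Hyperboloid

/-- The flux of the current through a curve of slope `q` controls the weighted flux density. -/
lemma flux_density_le {p γ r f a b G q : ℝ} (hp : 0 < p) (hr : 0 ≤ r) (hG : 0 ≤ G) (hq : 1 ≤ q)
    (hqr : 3 / 25 ≤ (q - 1) * r ^ 2) :
    r ^ γ * (r * (a + b) + f) ^ 2 + (a - b) ^ 2 + r ^ 2 * (a + b) ^ 2 + r ^ 2 * G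
        + 2 * r ^ 2 / (p + 1) * |f| ^ (p + 1)
      ≤ 34 * (q * curP p γ r f a b G - curQ p γ r f a b G) := by
  have hw := rpow_nonneg hr γ
  have hV : 0 ≤ |f| ^ (p + 1) / (p + 1) :=
    div_nonneg (rpow_nonneg (abs_nonneg f) _) (by linarith)
  have hq1 : 0 ≤ q - 1 := by linarith
  have e : 2 * r ^ 2 / (p + 1) * |f| ^ (p + 1) = 2 * r ^ 2 * (|f| ^ (p + 1) / (p + 1)) := by ring
  rw [e, curP, curQ]
  generalize |f| ^ (p + 1) / (p + 1) = V at *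
  generalize r ^ γ = w at *
  have h1 : 0 ≤ (q - 1) * (w * (r * (a + b) + f) ^ 2) := by positivity
  have h1' : 0 ≤ w * (r * (a + b) + f) ^ 2 := by positivity
  have h2 : 0 ≤ (q - 1) * (w * r ^ 2 * (G / 2 + V)) := by positivity
  have h3 : 0 ≤ (q - 1) * (r ^ 2 * (a + b) ^ 2) := by positivity
  have h3' : 0 ≤ r ^ 2 * (a + b) ^ 2 := by positivity
  have h4 : 0 ≤ ((q - 1) * r ^ 2 - 3 / 25) * (a - b) ^ 2 :=
    mul_nonneg (by linarith) (sq_nonneg _)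
  have h4' : 0 ≤ (a - b) ^ 2 := sq_nonneg _
  have h5 : 0 ≤ (q - 1) * (r ^ 2 * (G / 2 + V)) := by positivity
  have h5' : 0 ≤ r ^ 2 * G := by positivity
  have h5'' : 0 ≤ r ^ 2 * V := by positivity
  nlinarith

lemma inner_rotGen_self (k : Fin 3) (x : E3) : ⟪x, rotGen k x⟫_ℝ = 0 := by
  rw [PiLp.inner_apply, Fin.sum_univ_three]
  fin_cases k <;> simp [rotGen, bvec] <;> ring

section Translation

variable {φ : ℝ → E3 → ℝ}

lemma drad_eq_fderiv (φ : ℝ → E3 → ℝ) (t : ℝ) (x : E3) :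
    drad φ t x = fderiv ℝ (φ t) x (‖x‖⁻¹ • x) := by
  rw [drad, gradient, real_inner_comm, InnerProductSpace.toDual_symm_apply]

lemma norm_angGrad_sq (φ : ℝ → E3 → ℝ) (t : ℝ) {r : ℝ} (hr : 0 < r) {ω : E3} (hω : ‖ω‖ = 1) :
    ‖angGrad φ t (r • ω)‖ ^ 2 = ∑ k, fderiv ℝ (φ t) (r • ω) (rotGen k ω) ^ 2 := by
  have hu : ‖r • ω‖⁻¹ • r • ω = ω := by
    rw [norm_smul, hω, norm_of_nonneg hr.le, mul_one, smul_smul, inv_mul_cancel₀ hr.ne', one_smul]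
  have hn : ‖gradient (φ t) (r • ω)‖ = ‖fderiv ℝ (φ t) (r • ω)‖ := LinearIsometryEquiv.norm_map _ _
  have hd : ⟪gradient (φ t) (r • ω), ω⟫_ℝ = fderiv ℝ (φ t) (r • ω) ω := by
    rw [gradient, InnerProductSpace.toDual_symm_apply]
  rw [angGrad, drad_eq_fderiv, hu, norm_sub_sq_real, inner_smul_right, hd, hn, norm_smul, hω,
    norm_sq_clm_E3, ← sum_rotGen_clm_sq _ hω]
  simp only [mul_one, norm_eq_abs, sq_abs]
  ring

lemma dt1_eq_jet (hΦ : ContDiff ℝ 2 fun q : ℝ × E3 => φ q.1 q.2)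
    (t : ℝ) (x : E3) :
    dt1 φ t x = fderiv ℝ (fun q : ℝ × E3 => φ q.1 q.2) (t, x) (1, 0) := by
  have h := (hΦ.differentiable (by norm_num) (t, x)).hasFDerivAt.comp_hasDerivAt t
    ((hasDerivAt_id t).prodMk (hasDerivAt_const t x))
  exact h.deriv

lemma hasFDerivAt_slice (hΦ : ContDiff ℝ 2 fun q : ℝ × E3 => φ q.1 q.2)
    (t : ℝ) (x : E3) : HasFDerivAt (φ t)
    ((fderiv ℝ (fun q : ℝ × E3 => φ q.1 q.2) (t, x)).comp (ContinuousLinearMap.inr ℝ ℝ E3)) x :=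
  (hΦ.differentiable (by norm_num) (t, x)).hasFDerivAt.comp x
    (hasFDerivAt_prodMk_right t x)

lemma fderiv_slice_apply (hΦ : ContDiff ℝ 2 fun q : ℝ × E3 => φ q.1 q.2)
    (t : ℝ) (x v : E3) :
    fderiv ℝ (φ t) x v = fderiv ℝ (fun q : ℝ × E3 => φ q.1 q.2) (t, x) (0, v) := by
  rw [(hasFDerivAt_slice hΦ t x).fderiv]; simp

lemma dtt_eq_jet2 (hΦ : ContDiff ℝ 2 fun q : ℝ × E3 => φ q.1 q.2)
    (t r : ℝ) (ω : E3) :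
    dtt φ t (r • ω) = jet2 (fun q : ℝ × E3 => φ q.1 q.2) t r ω (1, 0) (1, 0) := by
  have h := hasDerivAt_jet1 hΦ ω (1, 0) (hasDerivAt_id t) (hasDerivAt_const t r)
  have e : (fun s => dt1 φ s (r • ω)) =
      fun s => jet1 (fun q : ℝ × E3 => φ q.1 q.2) (id s) r ω (1, 0) :=
    funext fun s => dt1_eq_jet hΦ s _
  rw [dtt, e, h.deriv]
  simp

lemma der2_eq_fderiv (hΦ : ContDiff ℝ 2 fun q : ℝ × E3 => φ q.1 q.2)
    (t : ℝ) (x v : E3) : der2 (φ t) x v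
    = fderiv ℝ (fderiv ℝ fun q : ℝ × E3 => φ q.1 q.2) (t, x) (0, v) (0, v) := by
  have hD : ContDiff ℝ 1 (fderiv ℝ fun q : ℝ × E3 => φ q.1 q.2) := hΦ.fderiv_right (by norm_num)
  have h := ((hD.differentiable (by norm_num) (t, x)).hasFDerivAt.comp x
    (hasFDerivAt_prodMk_right t x)).clm_apply (hasFDerivAt_const ((0 : ℝ), v) x)
  have e : (fun y => fderiv ℝ (φ t) y v) =
      fun y => (fderiv ℝ fun q : ℝ × E3 => φ q.1 q.2) (t, y) (0, v) :=
    funext fun y => fderiv_slice_apply hΦ t y v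
  rw [der2, e]
  refine (congrArg (fun ℓ : E3 →L[ℝ] ℝ => ℓ v) h.fderiv).trans ?_
  simp

lemma lap3_eq_jet2 (hΦ : ContDiff ℝ 2 fun q : ℝ × E3 => φ q.1 q.2)
    (t r : ℝ) {ω : E3} (hω : ‖ω‖ = 1) : lap3 (φ t) (r • ω)
    = jet2 (fun q : ℝ × E3 => φ q.1 q.2) t r ω (0, ω) (0, ω)
      + angTrace (fun q : ℝ × E3 => φ q.1 q.2) t r ω := by
  have h := sum_rotGen_bilin ((fderiv ℝ (fderiv ℝ fun q : ℝ × E3 => φ q.1 q.2)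
    (t, r • ω)).bilinearComp (ContinuousLinearMap.inr ℝ ℝ E3) (ContinuousLinearMap.inr ℝ ℝ E3)) hω
  simp only [ContinuousLinearMap.bilinearComp_apply, ContinuousLinearMap.inr_apply] at h
  simp only [lap3, der2_eq_fderiv hΦ, angTrace, jet2]
  exact h.symm

lemma drad_eq_jet (hΦ : ContDiff ℝ 2 fun q : ℝ × E3 => φ q.1 q.2)
    (t : ℝ) {r : ℝ} (hr : 0 < r) {ω : E3} (hω : ‖ω‖ = 1) :
    drad φ t (r • ω) = jet1 (fun q : ℝ × E3 => φ q.1 q.2) t r ω (0, ω) := by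
  have hu : ‖r • ω‖⁻¹ • r • ω = ω := by
    rw [norm_smul, hω, norm_of_nonneg hr.le, mul_one, smul_smul, inv_mul_cancel₀ hr.ne', one_smul]
  rw [drad_eq_fderiv, hu, fderiv_slice_apply hΦ, jet1]

lemma norm_fderiv_slice_sq (hΦ : ContDiff ℝ 2 fun q : ℝ × E3 => φ q.1 q.2)
    (t r : ℝ) {ω : E3} (hω : ‖ω‖ = 1) : ‖fderiv ℝ (φ t) (r • ω)‖ ^ 2
    = jet1 (fun q : ℝ × E3 => φ q.1 q.2) t r ω (0, ω) ^ 2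
      + angSq (fun q : ℝ × E3 => φ q.1 q.2) t r ω := by
  rw [norm_sq_clm_E3, ← sum_rotGen_clm_sq _ hω]
  simp only [fderiv_slice_apply hΦ, jet1, angSq]

lemma fderiv_rmul (hΦ : ContDiff ℝ 2 fun q : ℝ × E3 => φ q.1 q.2)
    (t : ℝ) {r : ℝ} (hr : 0 < r) {ω : E3} (hω : ‖ω‖ = 1) (v : E3) :
    fderiv ℝ (rmul φ t) (r • ω) v
      = ⟪ω, v⟫_ℝ * φ t (r • ω) + r * fderiv ℝ (φ t) (r • ω) v := by
  have hnr : ‖r • ω‖ = r := by rw [norm_smul, hω, norm_of_nonneg hr.le, mul_one]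
  have h1 := (hasStrictFDerivAt_norm_sq (r • ω)).hasFDerivAt.sqrt (by rw [hnr]; positivity)
  simp only [sqrt_sq (norm_nonneg _)] at h1
  have h := h1.mul (hasFDerivAt_slice hΦ t (r • ω)).differentiableAt.hasFDerivAt
  refine (congrArg (fun ℓ : E3 →L[ℝ] ℝ => ℓ v) h.fderiv).trans ?_
  simp only [hnr, _root_.add_apply, _root_.smul_apply, smul_eq_mul, innerSL_apply_apply,
    inner_smul_left, conj_trivial, nsmul_eq_mul]
  push_cast
  field_simp
  ring

lemma Lop_rmul (hΦ : ContDiff ℝ 2 fun q : ℝ × E3 => φ q.1 q.2)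
    (t : ℝ) {r : ℝ} (hr : 0 < r) {ω : E3} (hω : ‖ω‖ = 1) :
    Lop (rmul φ) t (r • ω) = r * (jet1 (fun q : ℝ × E3 => φ q.1 q.2) t r ω (1, 0)
      + jet1 (fun q : ℝ × E3 => φ q.1 q.2) t r ω (0, ω)) + φ t (r • ω) := by
  have hnr : ‖r • ω‖ = r := by rw [norm_smul, hω, norm_of_nonneg hr.le, mul_one]
  have hu : ‖r • ω‖⁻¹ • r • ω = ω := by
    rw [hnr, smul_smul, inv_mul_cancel₀ hr.ne', one_smul]
  have h1 : dt1 (rmul φ) t (r • ω) = r * dt1 φ t (r • ω) := by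
    simp only [dt1, rmul, hnr, deriv_const_mul_field]
  rw [Lop, drad_eq_fderiv, hu, fderiv_rmul hΦ t hr hω, h1, dt1_eq_jet hΦ, fderiv_slice_apply hΦ,
    real_inner_self_eq_norm_sq, hω, jet1, jet1]
  ring

lemma norm_angGrad_rmul_sq (hΦ : ContDiff ℝ 2 fun q : ℝ × E3 => φ q.1 q.2)
    (t : ℝ) {r : ℝ} (hr : 0 < r) {ω : E3} (hω : ‖ω‖ = 1) :
    ‖angGrad (rmul φ) t (r • ω)‖ ^ 2
      = r ^ 2 * angSq (fun q : ℝ × E3 => φ q.1 q.2) t r ω := by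
  simp only [norm_angGrad_sq _ t hr hω, fderiv_rmul hΦ t hr hω, inner_rotGen_self,
    fderiv_slice_apply hΦ, angSq, jet1, zero_mul, zero_add, mul_pow, Finset.mul_sum]

end Translation

section Hardy

variable {γ q R₀ K M : ℝ} {f f' : ℝ → ℝ}

lemma exists_abs_le_of_integral_rpow_le (hq : 0 < q) (hf : Continuous f) (R : ℝ)
    (hM : ∀ N, R ≤ N → ∫ r in R..N, |f r| ^ q ≤ M) {ε : ℝ} (hε : 0 < ε) :
    ∃ N, R ≤ N ∧ |f N| ≤ ε := by
  by_contra! h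
  have hεq : 0 < ε ^ q := rpow_pos_of_pos hε q
  obtain ⟨n, hn⟩ := exists_nat_gt (M / ε ^ q)
  have hRn : R ≤ R + n := by simp
  have c : Continuous fun r => |f r| ^ q := hf.abs.rpow_const fun _ => Or.inr hq.le
  have h1 : ∫ _ in R..(R + n), ε ^ q ≤ ∫ r in R..(R + n), |f r| ^ q :=
    intervalIntegral.integral_mono_on hRn intervalIntegrable_const (c.intervalIntegrable _ _)
      fun r hr => rpow_le_rpow hε.le (h r hr.1).le hq.le
  rw [intervalIntegral.integral_const, smul_eq_mul, add_sub_cancel_left] at h1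
  have h2 := hM _ hRn
  rw [div_lt_iff₀ hεq] at hn
  linarith

/-- Decay of a function with finite weighted Dirichlet integral and some finite Lebesgue norm. -/
lemma rpow_mul_sq_le (hγ : 0 ≤ γ) (hq : 0 < q) (hR₀ : 0 < R₀) (hf : ∀ r, HasDerivAt f (f' r) r)
    (cf' : Continuous f') (hK : ∀ R N, R₀ ≤ R → R ≤ N → ∫ r in R..N, r ^ (γ + 2) * f' r ^ 2 ≤ K)
    (hM : ∀ R N, R₀ ≤ R → R ≤ N → ∫ r in R..N, |f r| ^ q ≤ M) {R : ℝ} (hR : R₀ ≤ R) :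
    R ^ (γ + 1) * f R ^ 2 ≤ K := by
  have hRpos : 0 < R := hR₀.trans_le hR
  have hK0 : 0 ≤ K := by simpa using hK R R hR le_rfl
  have cf : Continuous f := continuous_iff_continuousAt.2 fun r => (hf r).continuousAt
  rcases eq_or_ne (f R) 0 with h0 | h0
  · simpa [h0] using hK0
  have hx : 0 < |f R| := abs_pos.2 h0
  set B := R ^ (-(γ + 1)) with hB
  have hBpos : 0 < B := rpow_pos_of_pos hRpos _
  have hl : 0 < B / |f R| := div_pos hBpos hx
  set l := B / |f R| with hl'
  have hmain : ∀ N, R ≤ N → |f R| ≤ |f N| + (l / 2 * K + B / (2 * l)) := by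
    intro N hN
    have hpos : ∀ r ∈ Set.Icc R N, 0 < r := fun r hr => hRpos.trans_le hr.1
    have c1 : Continuous fun r : ℝ => l / 2 * (r ^ (γ + 2) * f' r ^ 2) := by
      have : Continuous fun r : ℝ => r ^ (γ + 2) :=
        continuous_id.rpow_const fun _ => Or.inr (by linarith)
      fun_prop
    have i2 : IntervalIntegrable (fun r : ℝ => r ^ (-(γ + 2))) volume R N :=
      intervalIntegral.intervalIntegrable_rpow (Or.inr fun h => by
        rw [Set.uIcc_of_le hN] at h; exact (hpos 0 h).false)
    have h1 : f N - f R = ∫ r in R..N, f' r :=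
      (intervalIntegral.integral_eq_sub_of_hasDerivAt (fun r _ => hf r)
        (cf'.intervalIntegrable _ _)).symm
    have h2 : |∫ r in R..N, f' r|
        ≤ ∫ r in R..N, (l / 2 * (r ^ (γ + 2) * f' r ^ 2) + 1 / (2 * l) * r ^ (-(γ + 2))) := by
      refine (intervalIntegral.abs_integral_le_integral_abs hN).trans
        (intervalIntegral.integral_mono_on hN (cf'.abs.intervalIntegrable _ _)
          ((c1.intervalIntegrable _ _).add (i2.const_mul _)) fun r hr => ?_)
      have hw : 0 < r ^ (γ + 2) := rpow_pos_of_pos (hpos r hr) _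
      rw [rpow_neg (hpos r hr).le]
      generalize r ^ (γ + 2) = w at *
      have e : l / 2 * (w * f' r ^ 2) + 1 / (2 * l) * w⁻¹ - |f' r|
          = (l * w * |f' r| - 1) ^ 2 / (2 * l * w) := by
        rw [← sq_abs (f' r)]; field_simp; ring
      have : 0 ≤ (l * w * |f' r| - 1) ^ 2 / (2 * l * w) := by positivity
      linarith
    have h3 : ∫ r in R..N, r ^ (-(γ + 2)) ≤ B := by
      rw [integral_rpow (Or.inr ⟨by linarith, fun h => by
        rw [Set.uIcc_of_le hN] at h; exact (hpos 0 h).false⟩)]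
      have e : -(γ + 2) + 1 = -(γ + 1) := by ring
      have hNB : 0 ≤ N ^ (-(γ + 1)) := rpow_nonneg (hRpos.le.trans hN) _
      rw [e, ← hB, div_neg, ← neg_div, div_le_iff₀ (by linarith)]
      nlinarith
    rw [intervalIntegral.integral_add (c1.intervalIntegrable _ _) (i2.const_mul _),
      intervalIntegral.integral_const_mul, intervalIntegral.integral_const_mul] at h2
    have h4 := mul_le_mul_of_nonneg_left (hK R N hR hN) (by positivity : 0 ≤ l / 2)
    have h5 := mul_le_mul_of_nonneg_left h3 (by positivity : 0 ≤ 1 / (2 * l))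
    have h6 : |f R| ≤ |f N| + |f N - f R| := by
      have := abs_sub_abs_le_abs_sub (f R) (f N)
      rw [abs_sub_comm] at this; linarith
    rw [h1] at h6
    have : 1 / (2 * l) * B = B / (2 * l) := by ring
    linarith
  have hlim : |f R| ≤ l / 2 * K + B / (2 * l) := by
    refine le_of_forall_pos_le_add fun ε hε => ?_
    obtain ⟨N, hN, hfN⟩ := exists_abs_le_of_integral_rpow_le hq cf R (fun N => hM R N hR) hε
    linarith [hmain N hN]
  have e1 : B / (2 * l) = |f R| / 2 := by rw [hl']; field_simp
  have e2 : l / 2 * K = B * K / (2 * |f R|) := by rw [hl']; field_simp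
  rw [e1, e2] at hlim
  have h7 : |f R| / 2 ≤ B * K / (2 * |f R|) := by linarith
  rw [le_div_iff₀ (by positivity)] at h7
  have h8 : f R ^ 2 ≤ B * K := by rw [← sq_abs]; linarith
  have h9 : R ^ (γ + 1) * B = 1 := by rw [hB, ← rpow_add hRpos]; simp
  calc R ^ (γ + 1) * f R ^ 2 ≤ R ^ (γ + 1) * (B * K) :=
        mul_le_mul_of_nonneg_left h8 (rpow_nonneg hRpos.le _)
    _ = K := by rw [← mul_assoc, h9, one_mul]

/-- A Hardy-type inequality for `(r f)'`. -/
lemma integral_rpow_mul_sq_le (hγ : 0 ≤ γ) (hq : 0 < q) (hR₀ : 0 < R₀)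
    (hf : ∀ r, HasDerivAt f (f' r) r) (cf' : Continuous f')
    (hK : ∀ R N, R₀ ≤ R → R ≤ N → ∫ r in R..N, r ^ (γ + 2) * f' r ^ 2 ≤ K)
    (hM : ∀ R N, R₀ ≤ R → R ≤ N → ∫ r in R..N, |f r| ^ q ≤ M) {R : ℝ} (hR : R₀ ≤ R) :
    ∫ r in R₀..R, r ^ γ * (f r + r * f' r) ^ 2 ≤ 2 * K := by
  have cf : Continuous f := continuous_iff_continuousAt.2 fun r => (hf r).continuousAt
  have cγ : ∀ {δ : ℝ}, 0 ≤ δ → Continuous fun r : ℝ => r ^ δ := fun hδ =>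
    continuous_id.rpow_const fun _ => Or.inr hδ
  have c0 := cγ hγ
  have c2 := cγ (by linarith : 0 ≤ γ + 2)
  have c1 := cγ (by linarith : 0 ≤ γ + 1)
  have hb : ∫ r in R₀..R, ((γ + 1) * r ^ γ * f r ^ 2 + r ^ (γ + 1) * (2 * f r * f' r))
      = R ^ (γ + 1) * f R ^ 2 - R₀ ^ (γ + 1) * f R₀ ^ 2 := by
    refine intervalIntegral.integral_eq_sub_of_hasDerivAt
      (f := fun r => r ^ (γ + 1) * f r ^ 2) (fun r _ => ?_)
      (Continuous.intervalIntegrable (by fun_prop) _ _)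
    have h1 := Real.hasDerivAt_rpow_const (x := r) (p := γ + 1) (Or.inr (by linarith))
    refine (h1.mul ((hf r).pow 2)).congr_deriv ?_
    simp
  have hle : ∫ r in R₀..R, r ^ γ * (f r + r * f' r) ^ 2
      ≤ ∫ r in R₀..R, (r ^ (γ + 2) * f' r ^ 2
        + ((γ + 1) * r ^ γ * f r ^ 2 + r ^ (γ + 1) * (2 * f r * f' r))) := by
    refine intervalIntegral.integral_mono_on hR (Continuous.intervalIntegrable (by fun_prop) _ _)
      (Continuous.intervalIntegrable (by fun_prop) _ _) fun r hr => ?_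
    have hr0 : 0 < r := hR₀.trans_le hr.1
    have e1 : r ^ (γ + 1) = r ^ γ * r := by rw [rpow_add hr0, rpow_one]
    have e2 : r ^ (γ + 2) = r ^ γ * r ^ 2 := by rw [rpow_add hr0, rpow_two]
    have : 0 ≤ γ * (r ^ γ * f r ^ 2) := by positivity
    rw [e1, e2]
    nlinarith
  rw [intervalIntegral.integral_add (Continuous.intervalIntegrable (by fun_prop) _ _)
    (Continuous.intervalIntegrable (by fun_prop) _ _), hb] at hle
  have h1 := rpow_mul_sq_le hγ hq hR₀ hf cf' hK hM hR
  have h2 := hK R₀ R le_rfl hR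
  have h3 : 0 ≤ R₀ ^ (γ + 1) * f R₀ ^ 2 := by positivity
  linarith

end Hardy

lemma intervalIntegral_le_toReal_lintegral {I : ℝ → ℝ} (hI : Continuous I)
    (h0 : ∀ r, 0 ≤ r → 0 ≤ I r)
    (hJ : ∫⁻ r in Set.Ioi (0 : ℝ), ENNReal.ofReal (I r) ≠ ⊤) {a b : ℝ} (ha : 0 ≤ a) (hab : a ≤ b) :
    ∫ r in a..b, I r ≤ (∫⁻ r in Set.Ioi (0 : ℝ), ENNReal.ofReal (I r)).toReal := by
  rw [intervalIntegral.integral_of_le hab, integral_eq_lintegral_of_nonneg_ae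
    ((ae_restrict_mem measurableSet_Ioc).mono fun r hr => h0 r (ha.trans hr.1.le))
    hI.aestronglyMeasurable]
  exact ENNReal.toReal_mono hJ (lintegral_mono_set fun r hr => ha.trans_lt hr.1)

/-- Pointwise bound of the density by the energy density and the square of `(r f)'`. -/
lemma curP_le {p γ r f a b G : ℝ} (hp : 0 < p) (hγ : 0 ≤ γ) (hr : 1 ≤ r) (hG : 0 ≤ G) :
    curP p γ r f a b G ≤ 2 * (r ^ 2 * ((1 + r) ^ γ * (a ^ 2 + b ^ 2 + G + |f| ^ (p + 1))))
      + r ^ γ * (f + r * b) ^ 2 := by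
  have hN : 0 ≤ |f| ^ (p + 1) := rpow_nonneg (abs_nonneg f) _
  have hV : |f| ^ (p + 1) / (p + 1) ≤ |f| ^ (p + 1) := div_le_self hN (by linarith)
  have hV0 : 0 ≤ |f| ^ (p + 1) / (p + 1) := div_nonneg hN (by linarith)
  have hw1 : 1 ≤ r ^ γ := one_le_rpow hr hγ
  have hw : r ^ γ ≤ (1 + r) ^ γ := rpow_le_rpow (by linarith) (by linarith) hγ
  unfold curP
  generalize |f| ^ (p + 1) / (p + 1) = V at *
  generalize |f| ^ (p + 1) = N at *
  generalize r ^ γ = w at *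
  generalize (1 + r) ^ γ = W at *
  have hw0 : 0 ≤ w := by linarith
  have h1 : w * (r * (a + b) + f) ^ 2 / 2 ≤ w * (r ^ 2 * a ^ 2) + w * (f + r * b) ^ 2 := by
    have : (r * (a + b) + f) ^ 2 / 2 ≤ r ^ 2 * a ^ 2 + (f + r * b) ^ 2 := by
      nlinarith [sq_nonneg (r * a - (f + r * b))]
    nlinarith
  have h2 : r ^ 2 * (a ^ 2 / 2 + b ^ 2 / 2 + G / 2 + V)
      ≤ w * (r ^ 2 * (a ^ 2 / 2 + b ^ 2 / 2 + G / 2 + V)) :=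
    le_mul_of_one_le_left (by positivity) hw1
  have hW0 : 0 ≤ W := hw0.trans hw
  have h3 : w * (r ^ 2 * (a ^ 2 + b ^ 2 + G + V)) ≤ W * (r ^ 2 * (a ^ 2 + b ^ 2 + G + N)) := by
    gcongr
  have h4 : 0 ≤ w * (r ^ 2 * a ^ 2) := by positivity
  have h5 : 0 ≤ w * (r ^ 2 * b ^ 2) := by positivity
  have h6 : 0 ≤ w * (r ^ 2 * G) := by positivity
  nlinarith

section Initial

variable {p γ : ℝ} {Φ : ℝ × E3 → ℝ}

/-- Initial weighted energy density at the point `r ω`, in polar coordinates. -/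
def initDensity (p γ : ℝ) (Φ : ℝ × E3 → ℝ) (r : ℝ) (ω : E3) : ℝ :=
  r ^ 2 * ((1 + r) ^ γ * (jet1 Φ 0 r ω (1, 0) ^ 2 + jet1 Φ 0 r ω (0, ω) ^ 2 + angSq Φ 0 r ω
    + |Φ (0, r • ω)| ^ (p + 1)))

lemma initDensity_nonneg {r : ℝ} (hr : 0 ≤ r) (ω : E3) : 0 ≤ initDensity p γ Φ r ω := by
  have h1 := angSq_nonneg (Φ := Φ) 0 r ω
  have h2 : 0 ≤ |Φ (0, r • ω)| ^ (p + 1) := rpow_nonneg (abs_nonneg _) _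
  have h3 : 0 ≤ (1 + r) ^ γ := rpow_nonneg (by linarith) _
  unfold initDensity
  positivity

lemma continuous_initDensity (hp : 0 < p) (hγ : 0 ≤ γ) (hΦ : ContDiff ℝ 2 Φ) (ω : E3) :
    Continuous fun r => initDensity p γ Φ r ω := by
  have c0 : Continuous fun _ : ℝ => (0 : ℝ) := continuous_const
  have cω : Continuous fun _ : ℝ => ω := continuous_const
  have h1 := continuous_angSq hΦ c0 continuous_id cω
  have h2 : Continuous fun r : ℝ => |Φ (0, r • ω)| ^ (p + 1) :=
    (continuous_field hΦ c0 continuous_id cω).abs.rpow_const fun _ => Or.inr (by linarith)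
  have h3 : Continuous fun r : ℝ => (1 + r) ^ γ :=
    (continuous_const.add continuous_id).rpow_const fun _ => Or.inr hγ
  simp only [id] at h1
  unfold initDensity
  fun_prop (disch := assumption)

/-- Along each ray the initial density of the current is controlled by the weighted energy. -/
lemma ofReal_integral_fieldP_le (hp : 0 < p) (hγ : 1 ≤ γ) (hΦ : ContDiff ℝ 2 Φ) (ω : E3)
    {R₀ R : ℝ} (hR₀ : 1 ≤ R₀) (hR : R₀ ≤ R) :
    ENNReal.ofReal (∫ r in R₀..R, fieldP p γ Φ 0 r ω)
      ≤ 4 * ∫⁻ r in Set.Ioi (0 : ℝ), ENNReal.ofReal (initDensity p γ Φ r ω) := by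
  by_cases hJ : ∫⁻ r in Set.Ioi (0 : ℝ), ENNReal.ofReal (initDensity p γ Φ r ω) = ⊤
  · rw [hJ, ENNReal.mul_top (by norm_num)]; exact le_top
  have hγ0 : 0 ≤ γ := by linarith
  have c0 : Continuous fun _ : ℝ => (0 : ℝ) := continuous_const
  have cω : Continuous fun _ : ℝ => ω := continuous_const
  have cI := continuous_initDensity hp hγ0 hΦ ω
  have cf := continuous_field hΦ c0 continuous_id cω
  have cb : Continuous fun r : ℝ => jet1 Φ 0 r ω (0, ω) := by fun_prop (disch := assumption)
  have cP := continuous_fieldP hp hγ hΦ c0 continuous_id cω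
  have c2 : Continuous fun r : ℝ => r ^ (γ + 2) :=
    continuous_id.rpow_const fun _ => Or.inr (by linarith)
  have cγ : Continuous fun r : ℝ => r ^ γ := continuous_id.rpow_const fun _ => Or.inr hγ0
  have cN : Continuous fun r : ℝ => |Φ (0, r • ω)| ^ (p + 1) :=
    cf.abs.rpow_const fun _ => Or.inr (by linarith)
  simp only [id] at cf cP
  have hint := fun a b (ha : R₀ ≤ a) (hab : a ≤ b) => intervalIntegral_le_toReal_lintegral cI
    (fun r hr => initDensity_nonneg hr ω) hJ (by linarith : 0 ≤ a) hab
  have hpt : ∀ r, 1 ≤ r → r ^ (γ + 2) * jet1 Φ 0 r ω (0, ω) ^ 2 ≤ initDensity p γ Φ r ω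
      ∧ |Φ (0, r • ω)| ^ (p + 1) ≤ initDensity p γ Φ r ω := by
    intro r hr
    have h1 := angSq_nonneg (Φ := Φ) 0 r ω
    have h2 : 0 ≤ |Φ (0, r • ω)| ^ (p + 1) := rpow_nonneg (abs_nonneg _) _
    have hw1 : 1 ≤ r ^ γ := one_le_rpow hr hγ0
    have hw : r ^ γ ≤ (1 + r) ^ γ := rpow_le_rpow (by linarith) (by linarith) hγ0
    have e2 : r ^ (γ + 2) = r ^ 2 * r ^ γ := by rw [rpow_add (by linarith), rpow_two, mul_comm]
    have hr2 : 1 ≤ r ^ 2 := one_le_pow₀ hr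
    unfold initDensity
    constructor
    · rw [e2, mul_assoc]
      gcongr
      nlinarith [sq_nonneg (jet1 Φ 0 r ω (1, 0))]
    · have h3 : |Φ (0, r • ω)| ^ (p + 1) ≤ jet1 Φ 0 r ω (1, 0) ^ 2 + jet1 Φ 0 r ω (0, ω) ^ 2
          + angSq Φ 0 r ω + |Φ (0, r • ω)| ^ (p + 1) := by
        nlinarith [sq_nonneg (jet1 Φ 0 r ω (1, 0)), sq_nonneg (jet1 Φ 0 r ω (0, ω))]
      refine h3.trans ((le_mul_of_one_le_left (h2.trans h3) (hw1.trans hw)).trans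
        (le_mul_of_one_le_left ?_ hr2))
      exact mul_nonneg (by linarith) (h2.trans h3)
  have hdom : ∀ {g : ℝ → ℝ}, Continuous g → (∀ r, 1 ≤ r → g r ≤ initDensity p γ Φ r ω) →
      ∀ a b, R₀ ≤ a → a ≤ b → ∫ r in a..b, g r
        ≤ (∫⁻ r in Set.Ioi (0 : ℝ), ENNReal.ofReal (initDensity p γ Φ r ω)).toReal :=
    fun cg hg a b ha hab => (intervalIntegral.integral_mono_on hab (cg.intervalIntegrable _ _)
      (cI.intervalIntegrable _ _) fun r hr => hg r (hR₀.trans (ha.trans hr.1))).trans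
        (hint a b ha hab)
  have hhardy := integral_rpow_mul_sq_le (γ := γ) (q := p + 1) (f := fun r => Φ (0, r • ω))
    (f' := fun r => jet1 Φ 0 r ω (0, ω)) hγ0 (by linarith) (by linarith)
    (fun r => (hasDerivAt_jet0 hΦ ω (hasDerivAt_const r 0) (hasDerivAt_id r)).congr_deriv
      (by simp)) cb
    (hdom (by fun_prop) fun r hr => (hpt r hr).1) (hdom cN fun r hr => (hpt r hr).2) hR
  have hP : ∫ r in R₀..R, fieldP p γ Φ 0 r ω ≤ ∫ r in R₀..R, (2 * initDensity p γ Φ r ω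
      + r ^ γ * (Φ (0, r • ω) + r * jet1 Φ 0 r ω (0, ω)) ^ 2) :=
    intervalIntegral.integral_mono_on hR (cP.intervalIntegrable _ _)
      (Continuous.intervalIntegrable (by fun_prop) _ _) fun r hr =>
      curP_le hp hγ0 (hR₀.trans hr.1) (angSq_nonneg _ _ _)
  rw [intervalIntegral.integral_add (Continuous.intervalIntegrable (by fun_prop) _ _)
    (Continuous.intervalIntegrable (by fun_prop) _ _), intervalIntegral.integral_const_mul] at hP
  have hI := hint R₀ R le_rfl hR
  refine (ENNReal.ofReal_le_ofReal (by linarith : _ ≤ 4 *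
    (∫⁻ r in Set.Ioi (0 : ℝ), ENNReal.ofReal (initDensity p γ Φ r ω)).toReal)).trans ?_
  rw [ENNReal.ofReal_mul (by norm_num), ENNReal.ofReal_toReal hJ]
  simp

end Initial

section Final

variable {p γ : ℝ} {φ : ℝ → E3 → ℝ}

lemma lintegral_initDensity (hp : 0 < p) (hγ : 0 ≤ γ)
    (hΦ : ContDiff ℝ 2 fun q : ℝ × E3 => φ q.1 q.2) :
    ∫⁻ ω : Metric.sphere (0 : E3) 1, (∫⁻ r in Set.Ioi (0 : ℝ),
      ENNReal.ofReal (initDensity p γ (fun q : ℝ × E3 => φ q.1 q.2) r ω)) ∂sphereMeasure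
      = wEnergy p 0 γ φ := by
  have c1 : Continuous (fderiv ℝ fun q : ℝ × E3 => φ q.1 q.2) :=
    hΦ.continuous_fderiv (by norm_num)
  have cw : Continuous fun x : E3 => (1 + ‖x‖) ^ γ :=
    (continuous_const.add continuous_norm).rpow_const fun _ => Or.inr hγ
  have c0 : Continuous (φ 0) := hΦ.continuous.comp (Continuous.prodMk_right (0 : ℝ))
  have cdt : Continuous (dt1 φ 0) := by
    simp only [funext (dt1_eq_jet hΦ 0)]
    fun_prop
  have cdx : Continuous (fderiv ℝ (φ 0)) := by
    simp only [funext fun x => (hasFDerivAt_slice hΦ 0 x).fderiv]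
    fun_prop
  have cN : Continuous fun x => |φ 0 x| ^ (p + 1) :=
    c0.abs.rpow_const fun _ => Or.inr (by linarith)
  have hm : Measurable fun x : E3 => ENNReal.ofReal ((1 + ‖x‖) ^ γ *
      (‖fderiv ℝ (φ 0) x‖ ^ 2 + dt1 φ 0 x ^ 2)) :=
    (ENNReal.continuous_ofReal.comp (by fun_prop)).measurable
  have hm' : Measurable fun x : E3 => ENNReal.ofReal ((1 + ‖x‖) ^ γ * |φ 0 x| ^ (p + 1)) :=
    (ENNReal.continuous_ofReal.comp (by fun_prop)).measurable
  have e : wEnergy p 0 γ φ = ∫⁻ x : E3, (ENNReal.ofReal ((1 + ‖x‖) ^ γ *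
      (‖fderiv ℝ (φ 0) x‖ ^ 2 + dt1 φ 0 x ^ 2))
      + ENNReal.ofReal ((1 + ‖x‖) ^ γ * |φ 0 x| ^ (p + 1))) := by
    rw [lintegral_add_left hm]
    simp [wEnergy, norm_iteratedFDeriv_one]
  refine Eq.trans ?_ (e.trans (lintegral_polar_E3 (hm.add hm'))).symm
  refine lintegral_congr fun ω => setLIntegral_congr_fun measurableSet_Ioi fun r hr => ?_
  have hr : 0 < r := hr
  have hω : ‖(ω : E3)‖ = 1 := norm_eq_of_mem_sphere ω
  have hn : ‖r • (ω : E3)‖ = r := by rw [norm_smul, hω, norm_of_nonneg hr.le, mul_one]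
  have hw : 0 ≤ (1 + r) ^ γ := by positivity
  have hN : 0 ≤ |φ 0 (r • (ω : E3))| ^ (p + 1) := by positivity
  simp only [hn, norm_fderiv_slice_sq hΦ 0 r hω, dt1_eq_jet hΦ]
  have hG := angSq_nonneg (Φ := fun q : ℝ × E3 => φ q.1 q.2) 0 r ω
  rw [← ENNReal.ofReal_add (by positivity) (by positivity), ← ENNReal.ofReal_mul (by positivity)]
  congr 1
  simp only [initDensity, jet1]
  ring

/-- The flux density through the hyperboloid in the statement of the bound. -/
def hypFluxDensity (p γ : ℝ) (φ : ℝ → E3 → ℝ) (t : ℝ) (ω : E3) : ℝ :=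
  hypRho t ^ γ * Lop (rmul φ) t (hypRho t • ω) ^ 2
    + Lbop φ t (hypRho t • ω) ^ 2
    + hypRho t ^ 2 * Lop φ t (hypRho t • ω) ^ 2
    + ‖angGrad (rmul φ) t (hypRho t • ω)‖ ^ 2
    + 2 * hypRho t ^ 2 / (p + 1) * |φ t (hypRho t • ω)| ^ (p + 1)

/-- The current of `fieldP` and `fieldQ` through the hyperboloid. -/
def hypCurrent (p γ : ℝ) (Φ : ℝ × E3 → ℝ) (t : ℝ) (ω : E3) : ℝ :=
  hypRho' t * fieldP p γ Φ t (hypRho t) ω - fieldQ p γ Φ t (hypRho t) ω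

lemma hypFluxDensity_nonneg (hp : 0 < p) (t : ℝ) (ω : E3) : 0 ≤ hypFluxDensity p γ φ t ω := by
  have h1 : 0 ≤ hypRho t := sqrt_nonneg _
  have h2 : 0 ≤ |φ t (hypRho t • ω)| ^ (p + 1) := by positivity
  unfold hypFluxDensity
  positivity

lemma hypFluxDensity_le (hp : 0 < p) (hΦ : ContDiff ℝ 2 fun q : ℝ × E3 => φ q.1 q.2) {t : ℝ}
    (ht : 0 ≤ t) {ω : E3} (hω : ‖ω‖ = 1) :
    hypFluxDensity p γ φ t ω ≤ 34 * hypCurrent p γ (fun q : ℝ × E3 => φ q.1 q.2) t ω := by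
  have hρ : 0 < hypRho t := by linarith [two_le_hypRho ht]
  rw [hypFluxDensity, Lop_rmul hΦ t hρ hω, norm_angGrad_rmul_sq hΦ t hρ hω, Lop, Lbop,
    drad_eq_jet hΦ t hρ hω, dt1_eq_jet hΦ]
  exact flux_density_le hp hρ.le (angSq_nonneg _ _ _) (one_le_hypRho' ht)
    (hypRho'_sub_one_mul_sq ht)

lemma hypCurrent_nonneg (hp : 0 < p) (hΦ : ContDiff ℝ 2 fun q : ℝ × E3 => φ q.1 q.2) {t : ℝ}
    (ht : 0 ≤ t) {ω : E3} (hω : ‖ω‖ = 1) :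
    0 ≤ hypCurrent p γ (fun q : ℝ × E3 => φ q.1 q.2) t ω := by
  linarith [hypFluxDensity_nonneg (γ := γ) (φ := φ) hp t ω, hypFluxDensity_le (γ := γ) hp hΦ ht hω]

lemma continuous_hypCurrent (hp : 0 < p) (hγ : 1 ≤ γ) {Φ : ℝ × E3 → ℝ} (hΦ : ContDiff ℝ 2 Φ) :
    Continuous (Function.uncurry fun (t : ℝ) (ω : Metric.sphere (0 : E3) 1) =>
      hypCurrent p γ Φ t ω) := by
  have ct : Continuous fun q : ℝ × Metric.sphere (0 : E3) 1 => q.1 := continuous_fst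
  have cω : Continuous fun q : ℝ × Metric.sphere (0 : E3) 1 => (q.2 : E3) := by fun_prop
  have cr := continuous_hypRho.comp ct
  have cr' := continuous_hypRho'.comp ct
  exact (cr'.mul (continuous_fieldP hp hγ hΦ ct cr cω)).sub (continuous_fieldQ hp hγ hΦ ct cr cω)

lemma lintegral_hypCurrent_le (hp : 1 ≤ p) (hγ : 1 ≤ γ) (hγ2 : γ ≤ 2) (hγp : γ ≤ p - 1)
    (hφ : IsNLWSolution p φ) (hΦ : ContDiff ℝ 2 fun q : ℝ × E3 => φ q.1 q.2) {T : ℝ}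
    (hT : 0 ≤ T) :
    ∫⁻ t in Set.Ioc 0 T, (∫⁻ ω : Metric.sphere (0 : E3) 1,
      ENNReal.ofReal (hypCurrent p γ (fun q : ℝ × E3 => φ q.1 q.2) t ω) ∂sphereMeasure)
      ≤ 4 * wEnergy p 0 γ φ := by
  set Φ : ℝ × E3 → ℝ := fun q => φ q.1 q.2 with hΦdef
  have hp0 : 0 < p := by linarith
  have cF := continuous_hypCurrent hp0 hγ hΦ
  have hnn : ∀ t, 0 ≤ t → ∀ ω : Metric.sphere (0 : E3) 1, 0 ≤ hypCurrent p γ Φ t ω :=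
    fun t ht ω => hypCurrent_nonneg hp0 hΦ ht (norm_eq_of_mem_sphere ω)
  have hinner : ∀ t ∈ Set.Ioc 0 T, ∫⁻ ω : Metric.sphere (0 : E3) 1,
      ENNReal.ofReal (hypCurrent p γ Φ t ω) ∂sphereMeasure
      = ENNReal.ofReal (∫ ω : Metric.sphere (0 : E3) 1, hypCurrent p γ Φ t ω ∂sphereMeasure) :=
    fun t ht => (ofReal_integral_eq_lintegral_ofReal
      (cF.comp (Continuous.prodMk_right t)).integrable_sphere
      (ae_of_all _ fun ω => hnn t ht.1.le ω)).symm
  have cint : Continuous fun t => ∫ ω : Metric.sphere (0 : E3) 1, hypCurrent p γ Φ t ω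
      ∂sphereMeasure :=
    continuous_parametric_integral_of_continuous cF isCompact_univ |>.congr fun t => by
      rw [Measure.restrict_univ]
  rw [setLIntegral_congr_fun measurableSet_Ioc hinner, ← ofReal_integral_eq_lintegral_ofReal
    ((cint.intervalIntegrable 0 T).1) ((ae_restrict_mem measurableSet_Ioc).mono fun t ht =>
      integral_nonneg fun ω => hnn t ht.1.le ω), ← intervalIntegral.integral_of_le hT,
    intervalIntegral_sphere_swap cF]
  have hflux := integrated_flux_le hp hγ hγ2 hγp hΦ (ρ := hypRho) (ρ' := hypRho') (T := T)
    (fun ω hω t ht r => by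
      rw [← dtt_eq_jet2 hΦ, ← lap3_eq_jet2 hΦ t r hω]; exact hφ.2 t ht (r • ω)) hT
    continuous_hypRho continuous_hypRho' (fun t ht => hasDerivAt_hypRho ht)
    (fun t ht => by linarith [two_le_hypRho ht])
    (fun t ht => add_le_add ht.2 (hypRho_mono ht.1 ht.2))
  refine (ENNReal.ofReal_le_ofReal hflux).trans ?_
  have h0 : 1 ≤ hypRho 0 := by linarith [two_le_hypRho le_rfl]
  have hR : hypRho 0 ≤ T + hypRho T := by linarith [hypRho_mono le_rfl hT]
  have cP : Continuous (Function.uncurry fun (ω : Metric.sphere (0 : E3) 1) (r : ℝ) =>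
      fieldP p γ Φ 0 r ω) :=
    continuous_fieldP (X := Metric.sphere (0 : E3) 1 × ℝ) (t := fun _ => 0) (r := fun q => q.2)
      (ω := fun q => (q.1 : E3)) hp0 hγ hΦ continuous_const (by fun_prop) (by fun_prop)
  rw [ofReal_integral_eq_lintegral_ofReal
    (intervalIntegral.continuous_parametric_intervalIntegral_of_continuous' (μ := volume) cP
      (hypRho 0) (T + hypRho T)).integrable_sphere (ae_of_all _ fun ω =>
      intervalIntegral.integral_nonneg hR fun r hr =>
        fieldP_nonneg hp0 (by linarith [hr.1]) (ω : E3)),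
    ← lintegral_initDensity hp0 (by linarith) hΦ, ← lintegral_const_mul' _ _ (by norm_num)]
  exact lintegral_mono fun ω => ofReal_integral_fieldP_le hp0 hγ hΦ ω h0 hR

lemma lintegral_hypFluxDensity_le (hp : 1 ≤ p) (hγ : 1 ≤ γ) (hγ2 : γ ≤ 2) (hγp : γ ≤ p - 1)
    (hφ : IsNLWSolution p φ) :
    ∫⁻ t in Set.Ioi (0 : ℝ), (∫⁻ ω : Metric.sphere (0 : E3) 1,
      ENNReal.ofReal (hypFluxDensity p γ φ t ω) ∂sphereMeasure)
      ≤ ENNReal.ofReal 136 * wEnergy p 0 γ φ := by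
  have hΦ : ContDiff ℝ 2 fun q : ℝ × E3 => φ q.1 q.2 := contDiff_infty.1 hφ.1 2
  have hU : Set.Ioi (0 : ℝ) = ⋃ n : ℕ, Set.Ioc (0 : ℝ) n := by
    ext t
    simp only [Set.mem_Ioi, Set.mem_iUnion, Set.mem_Ioc, exists_and_left]
    exact ⟨fun h => ⟨h, exists_nat_ge t⟩, fun h => h.1⟩
  have hd : Directed (· ⊆ ·) fun n : ℕ => Set.Ioc (0 : ℝ) n :=
    Monotone.directed_le fun m n h => Set.Ioc_subset_Ioc_right (by exact_mod_cast h)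
  rw [hU, setLIntegral_iUnion_of_directed _ hd]
  refine iSup_le fun n => ?_
  have h34 : ∀ t ∈ Set.Ioc (0 : ℝ) n, ∫⁻ ω : Metric.sphere (0 : E3) 1,
      ENNReal.ofReal (hypFluxDensity p γ φ t ω) ∂sphereMeasure
      ≤ 34 * ∫⁻ ω : Metric.sphere (0 : E3) 1,
        ENNReal.ofReal (hypCurrent p γ (fun q : ℝ × E3 => φ q.1 q.2) t ω) ∂sphereMeasure := by
    intro t ht
    rw [← lintegral_const_mul' _ _ (by norm_num)]
    refine lintegral_mono fun ω => (ENNReal.ofReal_le_ofReal (hypFluxDensity_le (by linarith) hΦ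
      ht.1.le (norm_eq_of_mem_sphere ω))).trans_eq ?_
    rw [ENNReal.ofReal_mul (by norm_num)]
    simp
  refine (setLIntegral_mono' measurableSet_Ioc h34).trans ?_
  rw [lintegral_const_mul' _ _ (by norm_num)]
  refine (mul_le_mul_right
    (lintegral_hypCurrent_le hp hγ hγ2 hγp hφ hΦ n.cast_nonneg) _).trans_eq ?_
  rw [← mul_assoc]
  norm_num

end Final

/-- Weighted energy flux bound through the future hyperboloid `ℍ⁺`,
parameterized by `(t, ρ(t)ω)` with `ρ(t) = √((t+3)² − (6/5)(t+3))`, for `2 < p < 5`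
and `1 < γ₀ < min{2, p−1}`. -/
theorem nlw_hyperboloid_flux_bound (p γ₀ : ℝ) (hp2 : 2 < p) (hp5 : p < 5)
    (hγ₁ : 1 < γ₀) (hγ₂ : γ₀ < min 2 (p - 1)) :
    ∃ C : ℝ, 0 < C ∧ ∀ φ : ℝ → E3 → ℝ, IsNLWSolution p φ → wEnergy p 0 γ₀ φ < ⊤ →
      (∫⁻ t in Set.Ioi (0 : ℝ), ∫⁻ ω : Metric.sphere (0 : E3) 1,
        ENNReal.ofReal (hypRho t ^ γ₀ * Lop (rmul φ) t (hypRho t • (ω : E3)) ^ 2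
          + Lbop φ t (hypRho t • (ω : E3)) ^ 2
          + hypRho t ^ 2 * Lop φ t (hypRho t • (ω : E3)) ^ 2
          + ‖angGrad (rmul φ) t (hypRho t • (ω : E3))‖ ^ 2
          + 2 * hypRho t ^ 2 / (p + 1) * |φ t (hypRho t • (ω : E3))| ^ (p + 1))
          ∂sphereMeasure)
        ≤ ENNReal.ofReal C * wEnergy p 0 γ₀ φ := by
  obtain ⟨h2, hp1⟩ := lt_min_iff.1 hγ₂
  exact ⟨136, by norm_num, fun φ hφ _ =>
    lintegral_hypFluxDensity_le (by linarith) hγ₁.le h2.le hp1.le hφ⟩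
end
end

section
/- Let R > 1 and γ' < 1. There exists a constant C > 0, depending only on γ' and R, such that for every (t₀,x₀) with t₀ ≥ 0 and t₀ + |x₀| < R, and every r̃ with 0 ≤ r̃ ≤ t₀, setting t = t₀ − r̃, one has ∫_{S²} (R − t − |x₀+r̃ω̃|)^{−γ'} dσ(ω̃) ≤ C (R−t)^{γ'} (R−t₀)^{−γ'} (v₀ + r̃)^{−γ'}, where v₀ = R − t₀ − |x₀|. -/
open MeasureTheory Real
open scoped ENNReal InnerProductSpace

noncomputable section

/-- The singular weight `|x₁ x₂|^{-γ}` is integrable on the unit ball of `ℝ³` when `0 ≤ γ < 1`. -/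
lemma setLIntegral_ball_coord_mul_rpow_lt_top {γ : ℝ} (h0 : 0 ≤ γ) (h1 : γ < 1) :
    ∫⁻ x in Metric.ball (0 : E3) 1, ENNReal.ofReal |x 1 * x 2| ^ (-γ) < ⊤ := by
  set h : ℝ → ℝ := (Set.Ioo (-1 : ℝ) 1).indicator fun s => |s| ^ (-γ) with hdef
  have hint : Integrable h := by
    rw [hdef, integrable_indicator_iff measurableSet_Ioo]
    have hr : IntegrableOn (fun s : ℝ => |s| ^ (-γ)) (Set.Ioc 0 1) := by
      have := (intervalIntegrable_iff_integrableOn_Ioc_of_le zero_le_one).1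
        (intervalIntegral.intervalIntegrable_rpow' (a := 0) (b := 1) (by linarith : -1 < -γ))
      exact this.congr_fun (fun s hs => by simp only [abs_of_pos hs.1]) measurableSet_Ioc
    have hl : IntegrableOn (fun s : ℝ => |s| ^ (-γ)) (Set.Ico (-1) 0) := by
      have := hr.comp_neg
      simpa using this
    have hz : IntegrableOn (fun s : ℝ => |s| ^ (-γ)) {0} :=
      integrableOn_singleton (hx := by simp)
    refine ((hl.union hz).union hr).mono_set fun s hs => ?_
    rcases lt_trichotomy s 0 with h | h | h
    · exact Or.inl (Or.inl ⟨hs.1.le, h⟩)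
    · exact Or.inl (Or.inr h)
    · exact Or.inr ⟨h, hs.2.le⟩
  have hprod : Integrable (fun x : Fin 3 → ℝ => ∏ i, h (x i)) :=
    Integrable.fintype_prod (f := fun _ => h) fun _ => hint
  have hprod' : Integrable (fun x : E3 => ∏ i, h (x i)) :=
    (PiLp.volume_preserving_ofLp (Fin 3)).integrable_comp_of_integrable hprod
  refine lt_of_le_of_lt ?_ hprod'.lintegral_lt_top
  refine (lintegral_mono_ae ?_).trans (setLIntegral_le_lintegral (Metric.ball (0 : E3) 1) _)
  have hne (i : Fin 3) : ∀ᵐ x : E3, x i ≠ 0 :=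
    (PiLp.volume_preserving_ofLp (Fin 3)).quasiMeasurePreserving.ae
      (Measure.ae_eval_ne (μ := fun _ : Fin 3 => (volume : Measure ℝ)) i 0)
  rw [ae_restrict_iff' measurableSet_ball]
  filter_upwards [hne 0, hne 1, hne 2] with x hx0 hx1 hx2 hx
  have hlt (i : Fin 3) : |x i| < 1 :=
    (PiLp.norm_apply_le x i).trans_lt (by simpa using hx)
  have hh (i : Fin 3) : h (x i) = |x i| ^ (-γ) :=
    Set.indicator_of_mem (s := Set.Ioo (-1 : ℝ) 1) (abs_lt.1 (hlt i)) _
  rw [ENNReal.ofReal_rpow_of_pos (abs_pos.2 (mul_ne_zero hx1 hx2)), abs_mul,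
    Real.mul_rpow (abs_nonneg _) (abs_nonneg _)]
  refine ENNReal.ofReal_le_ofReal ?_
  rw [Fin.prod_univ_three, hh, hh, hh, mul_assoc]
  refine le_mul_of_one_le_left (by positivity) ?_
  exact Real.one_le_rpow_of_pos_of_le_one_of_nonpos (abs_pos.2 hx0) (hlt 0).le (by linarith)

/-- Averaging a function on the sphere by a function on the ball that dominates it radially. -/
lemma lintegral_sphere_le_setLIntegral_ball {f : Metric.sphere (0 : E3) 1 → ℝ≥0∞} {g : E3 → ℝ≥0∞}
    (hf : Measurable f)
    (hfg : ∀ (ω : Metric.sphere (0 : E3) 1) (s : ℝ), 0 < s → s < 1 → f ω ≤ g (s • (ω : E3))) :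
    ∫⁻ ω, f ω ∂sphereMeasure ≤ 3 * ∫⁻ x in Metric.ball (0 : E3) 1, g x := by
  set one : Set.Ioi (0 : ℝ) := ⟨1, Set.mem_Ioi.2 one_pos⟩
  have hdim : Module.finrank ℝ E3 - 1 = 2 := by simp
  have hvol : Measure.volumeIoiPow 2 (Set.Iio one) = 3⁻¹ := by
    rw [Measure.volumeIoiPow_apply_Iio, ← ENNReal.ofReal_ofNat 3,
      ← ENNReal.ofReal_inv_of_pos (by norm_num)]
    norm_num [one]
  have hmp := (volume : Measure E3).measurePreserving_homeomorphUnitSphereProd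
  rw [hdim] at hmp
  have key : (∫⁻ ω, f ω ∂sphereMeasure) * 3⁻¹ ≤ ∫⁻ x in Metric.ball (0 : E3) 1, g x := by
    calc
      _ = ∫⁻ p, f p.1 * (Set.Iio one).indicator 1 p.2
            ∂(sphereMeasure.prod (Measure.volumeIoiPow 2)) := by
          rw [lintegral_prod_mul hf.aemeasurable
            (measurable_one.indicator measurableSet_Iio).aemeasurable,
            lintegral_indicator_one measurableSet_Iio, hvol]
      _ = ∫⁻ x : ({0}ᶜ : Set E3), f (homeomorphUnitSphereProd E3 x).1 *
            (Set.Iio one).indicator 1 (homeomorphUnitSphereProd E3 x).2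
            ∂((volume : Measure E3).comap (↑)) :=
          (hmp.lintegral_comp ((hf.comp measurable_fst).mul
            ((measurable_one.indicator measurableSet_Iio).comp measurable_snd))).symm
      _ ≤ ∫⁻ x : ({0}ᶜ : Set E3), (Metric.ball (0 : E3) 1).indicator g x
            ∂((volume : Measure E3).comap (↑)) := by
          refine lintegral_mono fun x => ?_
          by_cases hx : (homeomorphUnitSphereProd E3 x).2 ∈ Set.Iio one
          · have hx' : ‖(x : E3)‖ < 1 := by
              simpa [one, ← Subtype.coe_lt_coe] using hx
            have hpos : 0 < ‖(x : E3)‖ := norm_pos_iff.2 x.2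
            rw [Set.indicator_of_mem hx, Set.indicator_of_mem (by simpa using hx'),
              Pi.one_apply, mul_one]
            refine (hfg _ _ hpos hx').trans_eq ?_
            simp [smul_smul, hpos.ne']
          · simp [Set.indicator_of_notMem hx]
      _ = ∫⁻ x in ({0}ᶜ : Set E3), (Metric.ball (0 : E3) 1).indicator g x :=
          lintegral_subtype_comap (measurableSet_singleton _).compl _
      _ ≤ _ := (setLIntegral_le_lintegral _ _).trans_eq
          (lintegral_indicator measurableSet_ball _)
  calc
    _ = 3 * ((∫⁻ ω, f ω ∂sphereMeasure) * 3⁻¹) := by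
        rw [mul_comm, mul_assoc, ENNReal.inv_mul_cancel (by norm_num) (by norm_num), mul_one]
    _ ≤ _ := by gcongr

/-- Uniform bound, over all orthonormal frames, of the weight `|y₁ y₂|^{-γ}` on the sphere. -/
lemma exists_lintegral_sphere_repr_mul_rpow_le {γ : ℝ} (h0 : 0 ≤ γ) (h1 : γ < 1) :
    ∃ M : ℝ≥0∞, M ≠ ⊤ ∧ ∀ b : OrthonormalBasis (Fin 3) ℝ E3,
      ∫⁻ ω, ENNReal.ofReal |b.repr (ω : E3) 1 * b.repr (ω : E3) 2| ^ (-γ) ∂sphereMeasure ≤ M := by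
  refine ⟨3 * ∫⁻ x in Metric.ball (0 : E3) 1, ENNReal.ofReal |x 1 * x 2| ^ (-γ),
    ENNReal.mul_ne_top (by norm_num) (setLIntegral_ball_coord_mul_rpow_lt_top h0 h1).ne,
    fun b => ?_⟩
  have hcont (i : Fin 3) : Continuous fun x : E3 => b.repr x i := by fun_prop
  refine (lintegral_sphere_le_setLIntegral_ball
    (g := fun x => ENNReal.ofReal |b.repr x 1 * b.repr x 2| ^ (-γ)) ?_ ?_).trans_eq ?_
  · exact (ENNReal.measurable_ofReal.comp ((((hcont 1).mul (hcont 2)).comp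
      continuous_subtype_val).abs.measurable)).pow_const _
  · intro ω s hs hs1
    rw [ENNReal.rpow_neg, ENNReal.rpow_neg]
    refine ENNReal.inv_le_inv.2 (ENNReal.rpow_le_rpow (ENNReal.ofReal_le_ofReal ?_) h0)
    simp only [map_smul, PiLp.smul_apply, smul_eq_mul, abs_mul, abs_of_pos hs]
    calc s * |b.repr ω 1| * (s * |b.repr ω 2|)
        = (s * s) * (|b.repr ω 1| * |b.repr ω 2|) := by ring
      _ ≤ _ := mul_le_of_le_one_left (by positivity) (by nlinarith)
  · congr 1
    have hpre : b.repr ⁻¹' Metric.ball (0 : E3) 1 = Metric.ball (0 : E3) 1 := by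
      ext x; simp
    have := b.measurePreserving_repr.setLIntegral_comp_preimage_emb
      b.repr.toHomeomorph.measurableEmbedding
      (fun x => ENNReal.ofReal |x 1 * x 2| ^ (-γ)) (Metric.ball (0 : E3) 1)
    rwa [hpre] at this

/-- Every vector points along the first vector of some orthonormal basis. -/
lemma exists_orthonormalBasis_eq_norm_smul (x : E3) :
    ∃ b : OrthonormalBasis (Fin 3) ℝ E3, x = ‖x‖ • b 0 := by
  obtain ⟨e, he, hx⟩ : ∃ e : E3, ‖e‖ = 1 ∧ x = ‖x‖ • e := by
    rcases eq_or_ne x 0 with rfl | hx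
    · exact ⟨EuclideanSpace.single 0 1, by simp, by simp⟩
    · exact ⟨‖x‖⁻¹ • x, by simp [norm_smul, hx], by simp [smul_smul, hx]⟩
  obtain ⟨b, hb⟩ := Orthonormal.exists_orthonormalBasis_extension_of_card_eq (𝕜 := ℝ) (E := E3)
    (ι := Fin 3) (by simp) (v := fun _ => e) (s := {0})
    (by
      rw [orthonormal_iff_ite]
      rintro ⟨i, hi⟩ ⟨j, hj⟩
      obtain rfl : i = 0 := hi
      obtain rfl : j = 0 := hj
      simp [Set.domRestrict, he])
  exact ⟨b, by rw [hb 0 rfl]; exact hx⟩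

lemma norm_sq_eq_sum_repr (b : OrthonormalBasis (Fin 3) ℝ E3) (x : E3) :
    ‖x‖ ^ 2 = b.repr x 0 ^ 2 + b.repr x 1 ^ 2 + b.repr x 2 ^ 2 := by
  rw [← b.repr.norm_map, EuclideanSpace.real_norm_sq_eq, Fin.sum_univ_three]

lemma abs_repr_zero_le_one (b : OrthonormalBasis (Fin 3) ℝ E3) (ω : Metric.sphere (0 : E3) 1) :
    |b.repr (ω : E3) 0| ≤ 1 :=
  (PiLp.norm_apply_le (b.repr (ω : E3)) 0).trans_eq
    ((b.repr.norm_map _).trans (norm_eq_of_mem_sphere ω))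

lemma norm_add_smul_sq (b : OrthonormalBasis (Fin 3) ℝ E3) {x : E3} (hx : x = ‖x‖ • b 0)
    (ω : Metric.sphere (0 : E3) 1) (r : ℝ) :
    ‖x + r • (ω : E3)‖ ^ 2 = ‖x‖ ^ 2 + r ^ 2 + 2 * r * ‖x‖ * b.repr (ω : E3) 0 := by
  have hin : ⟪x, (ω : E3)⟫_ℝ = ‖x‖ * b.repr (ω : E3) 0 := by
    conv_lhs => rw [hx, real_inner_smul_left]
    rw [b.repr_apply_apply]
  rw [norm_add_sq_real, real_inner_smul_right, hin, norm_smul, norm_eq_of_mem_sphere,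
    Real.norm_eq_abs, mul_one, sq_abs]
  ring

/-- Lower bound for the distance to the truncated cone in terms of the angle `z`. -/
lemma cone_gap_lower {T ρ r q z w : ℝ} (hρ : 0 ≤ ρ) (hT : ρ < T) (hr : 0 ≤ r)
    (hz : |z| ≤ 1) (hq : q ^ 2 = ρ ^ 2 + r ^ 2 + 2 * r * ρ * z) (hw : w ≤ 1 - z) :
    T * (T - ρ + r) / (4 * (T + r)) * w ≤ T + r - q := by
  obtain ⟨hz1, hz2⟩ := abs_le.1 hz
  have hqa : q ≤ T + r := by
    refine abs_le_of_sq_le_sq' ?_ (by linarith) |>.2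
    nlinarith [mul_nonneg (mul_nonneg hr hρ) (sub_nonneg.2 hz2), mul_nonneg hr (sub_pos.2 hT).le]
  have hw2 : T * (T - ρ + r) * w ≤ T * (T - ρ + r) * (1 - z) := by
    have : 0 < T * (T - ρ + r) := mul_pos (by linarith) (by linarith)
    gcongr
  have hz3 : T * (1 - z) ≤ 2 * (T - ρ * z) := by
    nlinarith [mul_nonneg (sub_pos.2 hT).le (by linarith : 0 ≤ 1 + z)]
  have h2 : T * (T - ρ + r) * (1 - z) ≤ 2 * ((T + r) ^ 2 - q ^ 2) := by
    rw [hq]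
    have hz4 : 0 ≤ T - ρ * z := by nlinarith
    nlinarith [mul_le_mul_of_nonneg_left hz3 hr, mul_nonneg hr hz4,
      mul_nonneg (mul_nonneg (by linarith : 0 ≤ T) (sub_pos.2 hT).le) (by linarith : 0 ≤ 1 + z),
      mul_nonneg hρ (sub_pos.2 hT).le]
  have h3 : 2 * ((T + r) ^ 2 - q ^ 2) ≤ (T + r - q) * (4 * (T + r)) := by
    nlinarith [sq_nonneg (T + r - q)]
  rw [div_mul_eq_mul_div, div_le_iff₀ (by linarith)]
  linarith

/-- Upper bound for the distance to the truncated cone. -/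
lemma cone_gap_upper {T ρ r q z : ℝ} (hρ : 0 ≤ ρ) (hT : ρ < T) (hr : 0 ≤ r) (hq0 : 0 ≤ q)
    (hz : |z| ≤ 1) (hq : q ^ 2 = ρ ^ 2 + r ^ 2 + 2 * r * ρ * z) (hqa : q ≤ T + r) :
    T + r - q ≤ 4 * (T * (T - ρ + r) / (T + r)) := by
  obtain ⟨hz1, hz2⟩ := abs_le.1 hz
  rw [← mul_div_assoc, le_div_iff₀ (by linarith)]
  have h1 : (T + r - q) * (T + r) ≤ (T + r) ^ 2 - q ^ 2 := by
    nlinarith [mul_nonneg (sub_nonneg.2 hqa) hq0]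
  refine h1.trans ?_
  rw [hq]
  nlinarith [mul_nonneg (mul_nonneg hr hρ) (by linarith : 0 ≤ 1 + z),
    mul_nonneg hr (sub_pos.2 hT).le, mul_pos (sub_pos.2 hT) (sub_pos.2 hT),
    mul_nonneg hρ (sub_pos.2 hT).le]

lemma mul_div_rpow_neg {T v a : ℝ} (hT : 0 ≤ T) (hv : 0 ≤ v) (ha : 0 ≤ a) (γ : ℝ) :
    (T * v / a) ^ (-γ) = a ^ γ * T ^ (-γ) * v ^ (-γ) := by
  rw [Real.div_rpow (mul_nonneg hT hv) ha, Real.mul_rpow hT hv, Real.rpow_neg ha, div_inv_eq_mul]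
  ring

/-- Sphere integration lemma on the truncated cone: for `R > 1`
and `γ' < 1` there is `C > 0` such that for `t₀ ≥ 0`, `t₀ + |x₀| < R`, `0 ≤ r̃ ≤ t₀`
and `t = t₀ − r̃`,
`∫_{S²} (R − t − |x₀+r̃ω̃|)^{−γ'} dσ ≤ C (R−t)^{γ'} (R−t₀)^{−γ'} (v₀+r̃)^{−γ'}`
where `v₀ = R − t₀ − |x₀|`. -/
theorem sphere_integration_cone (R γ' : ℝ) (hR : 1 < R) (hγ' : γ' < 1) :
    ∃ C : ℝ, 0 < C ∧ ∀ (t₀ : ℝ) (x₀ : E3) (r' : ℝ), 0 ≤ t₀ → t₀ + ‖x₀‖ < R →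
      0 ≤ r' → r' ≤ t₀ →
      (∫⁻ ω : Metric.sphere (0 : E3) 1,
        ENNReal.ofReal ((R - (t₀ - r') - ‖x₀ + r' • (ω : E3)‖) ^ (-γ')) ∂sphereMeasure)
        ≤ ENNReal.ofReal (C * (R - (t₀ - r')) ^ γ' * (R - t₀) ^ (-γ')
            * (R - t₀ - ‖x₀‖ + r') ^ (-γ')) := by
  obtain ⟨M, hM, hbound⟩ : ∃ M : ℝ≥0∞, M ≠ ⊤ ∧ ∀ (T : ℝ) (x : E3) (r : ℝ), ‖x‖ < T → 0 ≤ r →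
      ∫⁻ ω : Metric.sphere (0 : E3) 1,
        ENNReal.ofReal ((T + r - ‖x + r • (ω : E3)‖) ^ (-γ')) ∂sphereMeasure ≤
      ENNReal.ofReal ((T * (T - ‖x‖ + r) / (T + r)) ^ (-γ')) * M := by
    rcases le_total 0 γ' with h0 | h0
    · obtain ⟨M, hM, hb⟩ := exists_lintegral_sphere_repr_mul_rpow_le h0 hγ'
      refine ⟨ENNReal.ofReal (4⁻¹ ^ (-γ')) * M, ENNReal.mul_ne_top ENNReal.ofReal_ne_top hM,
        fun T x r hT hr => ?_⟩
      obtain ⟨b, hx⟩ := exists_orthonormalBasis_eq_norm_smul x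
      have hρ := norm_nonneg x
      have hA : 0 < T * (T - ‖x‖ + r) / (T + r) :=
        div_pos (mul_pos (by linarith) (by linarith)) (by linarith)
      rw [← mul_assoc, ← ENNReal.ofReal_mul (by positivity),
        ← Real.mul_rpow hA.le (by norm_num)]
      refine le_trans ?_ (mul_le_mul_right (hb b) _)
      rw [← lintegral_const_mul' _ _ ENNReal.ofReal_ne_top]
      refine lintegral_mono fun ω => ?_
      set w := |b.repr (ω : E3) 1 * b.repr (ω : E3) 2| with hwdef
      have hA' : 0 < T * (T - ‖x‖ + r) / (T + r) * 4⁻¹ := by positivity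
      have hw0 : 0 ≤ w := abs_nonneg _
      clear_value w
      rcases hw0.eq_or_lt with hw | hw
      · rcases h0.eq_or_lt with rfl | h0'
        · simp
        · rw [← hw, ENNReal.ofReal_zero, ENNReal.zero_rpow_of_neg (by linarith),
            ENNReal.mul_top (by simpa using Real.rpow_pos_of_pos hA' _)]
          exact le_top
      · rw [ENNReal.ofReal_rpow_of_pos hw, ← ENNReal.ofReal_mul (by positivity),
          ← Real.mul_rpow hA'.le hw.le]
        refine ENNReal.ofReal_le_ofReal
          (Real.rpow_le_rpow_of_nonpos (mul_pos hA' hw) ?_ (by linarith))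
        have hsq := norm_sq_eq_sum_repr b ω
        rw [norm_eq_of_mem_sphere] at hsq
        have hz := abs_repr_zero_le_one b ω
        refine le_trans (le_of_eq ?_) (cone_gap_lower hρ hT hr hz
          (norm_add_smul_sq b hx ω r) (w := w) ?_)
        · have : T + r ≠ 0 := by linarith
          field_simp
        · have hw2 : 2 * w ≤ b.repr (ω : E3) 1 ^ 2 + b.repr (ω : E3) 2 ^ 2 := by
            have := two_mul_le_add_sq |b.repr (ω : E3) 1| |b.repr (ω : E3) 2|
            rwa [sq_abs, sq_abs, mul_assoc, ← abs_mul, ← hwdef] at this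
          nlinarith [sq_nonneg (b.repr (ω : E3) 0 - 1)]
    · refine ⟨ENNReal.ofReal (4 ^ (-γ')) * sphereMeasure Set.univ,
        ENNReal.mul_ne_top ENNReal.ofReal_ne_top
          (measure_ne_top (volume : Measure E3).toSphere _), fun T x r hT hr => ?_⟩
      obtain ⟨b, hx⟩ := exists_orthonormalBasis_eq_norm_smul x
      have hρ := norm_nonneg x
      have hA : 0 < T * (T - ‖x‖ + r) / (T + r) :=
        div_pos (mul_pos (by linarith) (by linarith)) (by linarith)
      rw [← mul_assoc, ← ENNReal.ofReal_mul (by positivity),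
        ← Real.mul_rpow hA.le (by norm_num), ← lintegral_const]
      refine lintegral_mono fun ω => ENNReal.ofReal_le_ofReal ?_
      have hqa : ‖x + r • (ω : E3)‖ ≤ T + r := by
        refine (norm_add_le _ _).trans ?_
        rw [norm_smul, norm_eq_of_mem_sphere, Real.norm_of_nonneg hr]
        linarith
      refine Real.rpow_le_rpow (by linarith) ?_ (by linarith)
      rw [mul_comm]
      exact cone_gap_upper hρ hT hr (norm_nonneg _) (abs_repr_zero_le_one b ω)
        (norm_add_smul_sq b hx ω r) hqa
  refine ⟨M.toReal + 1, by positivity, fun t₀ x r h1 h2 h3 h4 => ?_⟩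
  have hρ := norm_nonneg x
  have hsum : R - (t₀ - r) = R - t₀ + r := by ring
  rw [hsum]
  refine (hbound (R - t₀) x r (by linarith) h3).trans ?_
  rw [mul_div_rpow_neg (by linarith) (by linarith) (by linarith), ← ENNReal.ofReal_toReal hM,
    ← ENNReal.ofReal_mul (mul_nonneg (mul_nonneg (Real.rpow_nonneg (by linarith) _)
      (Real.rpow_nonneg (by linarith) _)) (Real.rpow_nonneg (by linarith) _))]
  refine ENNReal.ofReal_le_ofReal ?_
  have hpos : 0 ≤ (R - t₀ + r) ^ γ' * (R - t₀) ^ (-γ') * (R - t₀ - ‖x‖ + r) ^ (-γ') :=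
    mul_nonneg (mul_nonneg (Real.rpow_nonneg (by linarith) _)
      (Real.rpow_nonneg (by linarith) _)) (Real.rpow_nonneg (by linarith) _)
  rw [ENNReal.toReal_ofReal ENNReal.toReal_nonneg]
  linarith
end
end
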